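/- For every ε ∈ (0,1) there exists C_ε > 0 such that for all (ℓ,m) ∈ ℕ×ℤ with |m| ≤ ℓ and |m| ≤ ε(ℓ+1/2): (a) |Ỹ_{ℓ,m}(x)| ≤ C_ε ((1+|m|)^{4/3} (1+ℓ)^{−2} + |x² − a_{ℓ,m}²|)^{−1/4} for all x ∈ [−1,1]; (b) if moreover |m| ≥ 1, then |Ỹ_{ℓ,m}(x)| ≤ C_ε b_{ℓ,m}^{−1/2} 2^{−|m|} for all x ∈ [−1,1] with (1−x²)^{1/2} ≤ b_{ℓ,m}/4. -/

import Mathlib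

open MeasureTheory Set
open scoped ENNReal NNReal

noncomputable section

/-- The Legendre polynomial `P_ℓ(x) = (2^ℓ ℓ!)⁻¹ (d/dx)^ℓ (x²−1)^ℓ`. -/
def legendreP (n : ℕ) (x : ℝ) : ℝ :=
  ((2:ℝ)^n * (Nat.factorial n : ℝ))⁻¹ * iteratedDeriv n (fun y => (y^2 - 1)^n) x

/-- The associated Legendre function `P_ℓ^m` for `0 ≤ m ≤ ℓ`
(on `[-1,1]`, where `√(1-x²)^m = (1-x²)^{m/2}`). -/
def assocP (n m : ℕ) (x : ℝ) : ℝ :=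
  (-1:ℝ)^m * Real.sqrt (1 - x^2) ^ m * iteratedDeriv m (legendreP n) x

/-- The associated Legendre function `P_ℓ^m` for integer `m` with `|m| ≤ ℓ`. -/
def assocPZ (n : ℕ) (m : ℤ) (x : ℝ) : ℝ :=
  if 0 ≤ m then assocP n m.toNat x
  else (-1:ℝ)^m.natAbs *
    ((Nat.factorial (n - m.natAbs) : ℝ) / (Nat.factorial (n + m.natAbs) : ℝ)) *
    assocP n m.natAbs x

/-- `Ỹ_{ℓ,m}(x) = ((2ℓ+1)/(4π) · (ℓ−m)!/(ℓ+m)!)^{1/2} P_ℓ^m(x)`. -/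
def tY (n : ℕ) (m : ℤ) (x : ℝ) : ℝ :=
  Real.sqrt (((2*(n:ℝ)+1) / (4*Real.pi)) *
    ((Nat.factorial ((n : ℤ) - m).toNat : ℝ) / (Nat.factorial ((n : ℤ) + m).toNat : ℝ))) *
  assocPZ n m x

/-- `b_{ℓ,m} = |m|/(ℓ+1/2)`. -/
def blm (n : ℕ) (m : ℤ) : ℝ := |(m : ℝ)| / ((n : ℝ) + 1/2)

/-- `a_{ℓ,m} = (1 − b_{ℓ,m}²)^{1/2}`. -/
def alm (n : ℕ) (m : ℤ) : ℝ := Real.sqrt (1 - blm n m ^ 2)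

/-- The system `(1-x²) y' = z`, `(1-x²) z' = -(L(1-x²)-m²) y` on `(0,1)` equivalent to the
associated Legendre equation, with the boundary behaviour at `1` of the regular solution. -/
structure IsLegendreSystem (L m : ℝ) (y z : ℝ → ℝ) : Prop where
  L_pos : 0 < L
  cont_y : ContinuousOn y (Icc 0 1)
  cont_z : ContinuousOn z (Icc 0 1)
  deriv_y : ∀ x ∈ Ioo (0:ℝ) 1, HasDerivAt y (z x / (1 - x^2)) x
  deriv_z : ∀ x ∈ Ioo (0:ℝ) 1, HasDerivAt z (-(L * (1 - x^2) - m^2) * y x / (1 - x^2)) x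
  z_one : z 1 = 0
  y_one : m * y 1 = 0

lemma le_of_weighted_deriv_nonpos {F F' : ℝ → ℝ} {a b : ℝ} (ha : 0 ≤ a) (hab : a ≤ b) (hb : b ≤ 1)
    (hc : ContinuousOn F (Icc a b))
    (hd : ∀ x ∈ Ioo a b, HasDerivAt F (F' x / (1 - x^2)) x)
    (hn : ∀ x ∈ Ioo a b, F' x ≤ 0) : F b ≤ F a := by
  have h : AntitoneOn F (Icc a b) := by
    apply antitoneOn_of_deriv_nonpos (convex_Icc a b) hc
    · intro x hx
      rw [interior_Icc] at hx
      exact (hd x hx).differentiableAt.differentiableWithinAt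
    · intro x hx
      rw [interior_Icc] at hx
      rw [(hd x hx).deriv]
      apply div_nonpos_of_nonpos_of_nonneg (hn x hx)
      nlinarith [hx.1, hx.2]
  exact h (left_mem_Icc.2 hab) (right_mem_Icc.2 hab) hab

namespace IsLegendreSystem

variable {L m : ℝ} {y z : ℝ → ℝ}

lemma cont_y_on (h : IsLegendreSystem L m y z) {a b : ℝ} (ha : 0 ≤ a) (hb : b ≤ 1) :
    ContinuousOn y (Icc a b) := h.cont_y.mono (Icc_subset_Icc ha hb)

lemma cont_z_on (h : IsLegendreSystem L m y z) {a b : ℝ} (ha : 0 ≤ a) (hb : b ≤ 1) :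
    ContinuousOn z (Icc a b) := h.cont_z.mono (Icc_subset_Icc ha hb)

lemma one_sub_sq_pos {a b x : ℝ} (ha : 0 ≤ a) (hb : b ≤ 1) (hx : x ∈ Ioo a b) : 0 < 1 - x^2 := by
  nlinarith [hx.1, hx.2]

lemma mem_unit {a b x : ℝ} (ha : 0 ≤ a) (hb : b ≤ 1) (hx : x ∈ Ioo a b) : x ∈ Ioo (0:ℝ) 1 :=
  ⟨ha.trans_lt hx.1, hx.2.trans_le hb⟩

lemma hasDerivAt_potential (L m x : ℝ) :
    HasDerivAt (fun x : ℝ => L * (1 - x^2) - m^2) (-(2 * L * x)) x := by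
  have := (((hasDerivAt_id x).pow 2).const_sub 1).const_mul L |>.sub_const (m^2)
  refine this.congr_deriv ?_
  simp; ring

lemma energy_le (h : IsLegendreSystem L m y z) {a b : ℝ} (ha : 0 ≤ a) (hab : a ≤ b) (hb : b ≤ 1) :
    (L * (1 - b^2) - m^2) * y b^2 + z b^2 ≤ (L * (1 - a^2) - m^2) * y a^2 + z a^2 := by
  have hy := h.cont_y_on ha hb
  have hz := h.cont_z_on ha hb
  refine le_of_weighted_deriv_nonpos (F := fun x => (L * (1 - x^2) - m^2) * y x^2 + z x^2)
    (F' := fun x => -(2 * x * (L * (1 - x^2)) * y x^2)) ha hab hb (by fun_prop) ?_ ?_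
  · intro x hx
    have h1 := one_sub_sq_pos ha hb hx
    have hx' := mem_unit ha hb hx
    refine (((hasDerivAt_potential L m x).mul ((h.deriv_y x hx').pow 2)).add
      ((h.deriv_z x hx').pow 2)).congr_deriv ?_
    simp
    field_simp
    ring
  · intro x hx
    have h1 := one_sub_sq_pos ha hb hx
    have hx' := mem_unit ha hb hx
    have := h.L_pos
    have := hx'.1
    simp only [Left.neg_nonpos_iff]
    positivity

/-- The squared amplitude of the Liouville–Green approximation. -/
def amplitude (L m : ℝ) (y z : ℝ → ℝ) (x : ℝ) : ℝ :=
  √(L * (1 - x^2) - m^2) * y x^2 +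
    (z x - x * (L * (1 - x^2)) / (2 * (L * (1 - x^2) - m^2)) * y x)^2 / √(L * (1 - x^2) - m^2)

lemma amplitude_deriv_nonpos {a x q Q S p Y E : ℝ} (ha : 0 < a) (hax : a ≤ x) (hx : x ≤ 1)
    (hq : 0 < q) (hQ : Q = q^2) (hS : Q ≤ S) {P : ℝ} (hP : P = p)
    (hE : E = q * Y^2 + p^2 / q) :
    -(2 * P * Y / q * ((1 - 3 * x^2) * S / (2 * Q) + 5 / 4 * x^2 * S^2 / Q^2))
      - 9 / (4 * a) * (x * S * (3 * S - 2 * Q) / q^5) * E ≤ 0 := by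
  have hQ0 : 0 < Q := by rw [hQ]; positivity
  have hS0 : 0 < S := hQ0.trans_le hS
  have hx0 : 0 < x := ha.trans_le hax
  have hx2 : x^2 ≤ 1 := by nlinarith
  have hSQ : S / Q ≤ S^2 / Q^2 := by
    rw [div_le_div_iff₀ hQ0 (by positivity)]
    nlinarith [mul_le_mul_of_nonneg_left hS (mul_pos hS0 hQ0).le]
  have hH : |(1 - 3 * x^2) * S / (2 * Q) + 5 / 4 * x^2 * S^2 / Q^2| ≤ 9 / 4 * (S^2 / Q^2) := by
    have e : (1 - 3 * x^2) * S / (2 * Q) + 5 / 4 * x^2 * S^2 / Q^2 =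
      (1 - 3 * x^2) / 2 * (S / Q) + 5 / 4 * x^2 * (S^2 / Q^2) := by
      field_simp
    have h0 : 0 < S / Q := by positivity
    have h1 : (1 - 3 * x^2) / 2 * (S / Q) ≤ 1 * (S / Q) := by gcongr; nlinarith
    have h2 : (-1) * (S / Q) ≤ (1 - 3 * x^2) / 2 * (S / Q) := by gcongr; nlinarith
    have h3 : x^2 * (S^2 / Q^2) ≤ 1 * (S^2 / Q^2) := by gcongr
    have h4 : 0 ≤ x^2 * (S^2 / Q^2) := by positivity
    rw [e, abs_le]
    constructor <;> linarith
  have hpY : |2 * p * Y| ≤ E := by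
    have e1 : E - 2 * p * Y = (q * Y - p)^2 / q := by rw [hE]; field_simp; ring
    have e2 : E + 2 * p * Y = (q * Y + p)^2 / q := by rw [hE]; field_simp; ring
    have h1 : 0 ≤ (q * Y - p)^2 / q := by positivity
    have h2 : 0 ≤ (q * Y + p)^2 / q := by positivity
    rw [abs_le]
    constructor <;> linarith
  have hE0 : 0 ≤ E := (abs_nonneg _).trans hpY
  have h5 : 9 / 4 * (S^2 / q^5) * E ≤ 9 / (4 * a) * (x * S * (3 * S - 2 * Q) / q^5) * E := by
    gcongr ?_ * E
    calc 9 / 4 * (S^2 / q^5) = 9 / (4 * a) * (a * S * S / q^5) := by field_simp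
      _ ≤ _ := by gcongr; linarith
  have h6 : -(2 * P * Y / q * ((1 - 3 * x^2) * S / (2 * Q) + 5 / 4 * x^2 * S^2 / Q^2)) ≤
      9 / 4 * (S^2 / q^5) * E := by
    refine (neg_le_abs _).trans ?_
    rw [hP, abs_mul, abs_div, abs_of_pos hq]
    calc _ ≤ E / q * (9 / 4 * (S^2 / Q^2)) := by gcongr
      _ = _ := by rw [hQ]; field_simp
  linarith

lemma amplitude_le (h : IsLegendreSystem L m y z) {a b : ℝ} (ha : 0 < a) (hab : a ≤ b)
    (hb : b ≤ 1) (hQ : 1 ≤ L * (1 - b^2) - m^2) (hQ3 : m^4 ≤ (L * (1 - b^2) - m^2)^3) :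
    amplitude L m y z b ≤ amplitude L m y z a * Real.exp (9 / (2 * a)) := by
  have hL := h.L_pos
  have hy := h.cont_y_on ha.le hb
  have hz := h.cont_z_on ha.le hb
  have hQpos : ∀ x ∈ Icc a b, 1 ≤ L * (1 - x^2) - m^2 := by
    intro x hx
    have : x^2 ≤ b^2 := by have := hx.1; have := hx.2; have := ha.trans_le hx.1; gcongr
    nlinarith
  have hmain : amplitude L m y z b *
        Real.exp (-(9 / (4 * a) * (L * (1 - b^2) / √(L * (1 - b^2) - m^2)^3))) ≤
      amplitude L m y z a *
        Real.exp (-(9 / (4 * a) * (L * (1 - a^2) / √(L * (1 - a^2) - m^2)^3))) := by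
    refine le_of_weighted_deriv_nonpos (F := fun x => amplitude L m y z x *
        Real.exp (-(9 / (4 * a) * (L * (1 - x^2) / √(L * (1 - x^2) - m^2)^3))))
      (F' := fun x => Real.exp (-(9 / (4 * a) * (L * (1 - x^2) / √(L * (1 - x^2) - m^2)^3))) *
        (-(2 * (z x - x * (L * (1 - x^2)) / (2 * (L * (1 - x^2) - m^2)) * y x) * y x
            / √(L * (1 - x^2) - m^2) *
          ((1 - 3 * x^2) * (L * (1 - x^2)) / (2 * (L * (1 - x^2) - m^2)) +
            5 / 4 * x^2 * (L * (1 - x^2))^2 / (L * (1 - x^2) - m^2)^2))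
          - 9 / (4 * a) * (x * (L * (1 - x^2)) * (3 * (L * (1 - x^2)) - 2 * (L * (1 - x^2) - m^2))
              / √(L * (1 - x^2) - m^2)^5) * amplitude L m y z x)) ha.le hab hb ?_ ?_ ?_
    · unfold amplitude
      have h1 : ∀ x ∈ Icc a b, √(L * (1 - x^2) - m^2) ≠ 0 := fun x hx =>
        (Real.sqrt_pos.2 (by linarith [hQpos x hx])).ne'
      have h2 : ∀ x ∈ Icc a b, √(L * (1 - x^2) - m^2)^3 ≠ 0 := fun x hx => pow_ne_zero _ (h1 x hx)
      have h3 : ∀ x ∈ Icc a b, 2 * (L * (1 - x^2) - m^2) ≠ 0 := fun x hx => by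
        linarith [hQpos x hx]
      fun_prop (disch := assumption)
    · intro x hx
      have h1 := one_sub_sq_pos ha.le hb hx
      have hx' := mem_unit ha.le hb hx
      have hq1 := hQpos x (Ioo_subset_Icc_self hx)
      have hq0 : 0 < √(L * (1 - x^2) - m^2) := Real.sqrt_pos.2 (by linarith)
      have hsq : √(L * (1 - x^2) - m^2) ^ 2 = L * (1 - x^2) - m^2 := Real.sq_sqrt (by linarith)
      have dQ := hasDerivAt_potential L m x
      have dq := dQ.sqrt (by linarith)
      have dS : HasDerivAt (fun x : ℝ => L * (1 - x^2)) (-(2 * L * x)) x := by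
        simpa using hasDerivAt_potential L 0 x
      have dy := h.deriv_y x hx'
      have dz := h.deriv_z x hx'
      have dp := dz.sub ((((hasDerivAt_id x).mul dS).div (dQ.const_mul 2) (by linarith)).mul dy)
      have dE := (dq.mul (dy.pow 2)).add ((dp.pow 2).div dq hq0.ne')
      have dPhi := ((dS.div (dq.pow 3) (pow_ne_zero 3 hq0.ne')).const_mul (9 / (4 * a))).neg.exp
      have := dE.mul dPhi
      refine this.congr_deriv ?_
      simp only [amplitude]
      simp
      generalize Real.exp _ = e
      generalize hq : √(L * (1 - x^2) - m^2) = q at *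
      have hm : m^2 = L * (1 - x^2) - q^2 := by linarith
      rw [← hsq, hm]
      generalize y x = Y
      generalize z x = Z
      field_simp
      ring
    · intro x hx
      have h1 := one_sub_sq_pos ha.le hb hx
      have hx' := mem_unit ha.le hb hx
      have hq1 := hQpos x (Ioo_subset_Icc_self hx)
      have hsq : √(L * (1 - x^2) - m^2) ^ 2 = L * (1 - x^2) - m^2 := Real.sq_sqrt (by linarith)
      refine mul_nonpos_of_nonneg_of_nonpos (Real.exp_pos _).le ?_
      exact amplitude_deriv_nonpos ha hx.1.le hx'.2.le (Real.sqrt_pos.2 (by linarith)) hsq.symm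
        (by nlinarith) rfl rfl
  have hq1 : 1 ≤ √(L * (1 - b^2) - m^2) := Real.one_le_sqrt.2 hQ
  have hsq : √(L * (1 - b^2) - m^2) ^ 2 = L * (1 - b^2) - m^2 := Real.sq_sqrt (by linarith)
  have hEa : 0 ≤ amplitude L m y z a := by unfold amplitude; positivity
  have ha1 : 0 ≤ 1 - a^2 := by nlinarith
  have hPhi : L * (1 - b^2) / √(L * (1 - b^2) - m^2)^3 ≤ 2 := by
    generalize √(L * (1 - b^2) - m^2) = q at *
    rw [div_le_iff₀ (by positivity)]
    have hm : m^2 ≤ q^3 := by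
      rw [← hsq] at hQ3
      refine le_of_sq_le_sq ?_ (by positivity)
      nlinarith
    nlinarith [mul_le_mul_of_nonneg_left hq1 (sq_nonneg q)]
  calc amplitude L m y z b = amplitude L m y z b *
        Real.exp (-(9 / (4 * a) * (L * (1 - b^2) / √(L * (1 - b^2) - m^2)^3))) *
        Real.exp (9 / (4 * a) * (L * (1 - b^2) / √(L * (1 - b^2) - m^2)^3)) := by
        rw [mul_assoc, ← Real.exp_add]; simp
    _ ≤ amplitude L m y z a * Real.exp (9 / (4 * a) * 2) := by
        gcongr
        refine hmain.trans (mul_le_of_le_one_right hEa (Real.exp_le_one_iff.2 ?_))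
        rw [neg_nonpos]
        positivity
    _ = _ := by congr 2; ring

lemma abs_le_of_potential_nonneg (h : IsLegendreSystem L m y z) {a b B : ℝ} (ha : 0 < a)
    (hab : a ≤ b) (hb : b ≤ 1) (hm : 0 < m) (hQ : 0 ≤ L * (1 - b^2) - m^2) (hB0 : 0 ≤ B)
    (hB : (L * (1 - a^2) - m^2) * y a^2 + z a^2 ≤ B^2) :
    |y b| ≤ |y a| + B * (L * (1 - a^2) - m^2) / (2 * a * m^2) := by
  have hL := h.L_pos
  have hy := h.cont_y_on ha.le hb
  have hs : ∀ s : ℝ, |s| = 1 →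
      s * y b + B / (2 * a * m^2) * (L * (1 - b^2) - m^2) ≤
        s * y a + B / (2 * a * m^2) * (L * (1 - a^2) - m^2) := by
    intro s hs
    refine le_of_weighted_deriv_nonpos
      (F := fun x => s * y x + B / (2 * a * m^2) * (L * (1 - x^2) - m^2))
      (F' := fun x => s * z x - B * (x / a) * (L * (1 - x^2) / m^2)) ha.le hab hb
      (by fun_prop) ?_ ?_
    · intro x hx
      have h1 := one_sub_sq_pos ha.le hb hx
      refine (((h.deriv_y x (mem_unit ha.le hb hx)).const_mul s).add
        ((hasDerivAt_potential L m x).const_mul (B / (2 * a * m^2)))).congr_deriv ?_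
      field_simp
      ring
    · intro x hx
      have h1 := one_sub_sq_pos ha.le hb hx
      have hx' := mem_unit ha.le hb hx
      have hQx : 0 ≤ L * (1 - x^2) - m^2 := by
        have : x^2 ≤ b^2 := by have := hx.2; have := hx'.1; gcongr
        nlinarith
      have hz2 : z x^2 ≤ B^2 := by
        have := h.energy_le ha.le hx.1.le hx'.2.le
        nlinarith [mul_nonneg hQx (sq_nonneg (y x))]
      have hz : s * z x ≤ B := by
        refine (le_abs_self _).trans ?_
        rw [abs_mul, hs, one_mul]
        exact abs_le_of_sq_le_sq hz2 hB0
      have h3 : 1 ≤ x / a := by rw [one_le_div ha]; exact hx.1.le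
      have h4 : 1 ≤ L * (1 - x^2) / m^2 := by rw [one_le_div (by positivity)]; linarith
      have h5 : B ≤ B * (x / a) * (L * (1 - x^2) / m^2) := by
        calc B = B * 1 * 1 := by ring
          _ ≤ _ := by gcongr
      linarith
  have h6 : 0 ≤ B / (2 * a * m^2) * (L * (1 - b^2) - m^2) := by positivity
  have h7 : B * (L * (1 - a^2) - m^2) / (2 * a * m^2) =
    B / (2 * a * m^2) * (L * (1 - a^2) - m^2) := by ring
  have hp := hs 1 (by simp)
  have hn := hs (-1) (by simp)
  rw [h7, abs_le]
  constructor
  · linarith [neg_abs_le (y a)]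
  · linarith [le_abs_self (y a)]

lemma potential_nonpos_of_le (h : IsLegendreSystem L m y z) {a b : ℝ} (ha : 0 ≤ a) (hab : a ≤ b)
    (hQ : L * (1 - a^2) - m^2 ≤ 0) : L * (1 - b^2) - m^2 ≤ 0 := by
  have hL := h.L_pos
  have : a^2 ≤ b^2 := by gcongr
  nlinarith

lemma mul_nonpos_of_potential_nonpos (h : IsLegendreSystem L m y z) {a : ℝ} (ha : 0 ≤ a)
    (ha1 : a ≤ 1) (hQ : L * (1 - a^2) - m^2 ≤ 0) : y a * z a ≤ 0 := by
  have hy := h.cont_y_on ha le_rfl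
  have hz := h.cont_z_on ha le_rfl
  have := le_of_weighted_deriv_nonpos (F := fun x => -(y x * z x))
    (F' := fun x => -(z x^2 + -(L * (1 - x^2) - m^2) * y x^2)) ha ha1 le_rfl (by fun_prop) ?_ ?_
  · simpa [h.z_one] using this
  · intro x hx
    have h1 := one_sub_sq_pos ha le_rfl hx
    have hx' := mem_unit ha le_rfl hx
    refine ((h.deriv_y x hx').mul (h.deriv_z x hx')).neg.congr_deriv ?_
    field_simp
  · intro x hx
    have hQx := h.potential_nonpos_of_le ha hx.1.le hQ
    have : 0 ≤ -(L * (1 - x^2) - m^2) := by linarith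
    simp only [Left.neg_nonpos_iff]
    positivity

lemma mul_le_of_potential_nonpos (h : IsLegendreSystem L m y z) {a r : ℝ} (ha : 0 ≤ a)
    (ha1 : a ≤ 1) (hQ : r^2 ≤ m^2 - L * (1 - a^2)) (hm : 0 < m) :
    y a * z a ≤ -(r * y a^2) := by
  have h0 := h.mul_nonpos_of_potential_nonpos ha ha1 (by nlinarith [sq_nonneg r])
  have h1 := h.energy_le ha ha1 le_rfl
  have hy1 : y 1 = 0 := by simpa [hm.ne'] using h.y_one
  rw [h.z_one, hy1] at h1
  have h2 : (r * y a)^2 ≤ z a^2 := by nlinarith [mul_le_mul_of_nonneg_right hQ (sq_nonneg (y a))]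
  have h3 : |r * y a| ≤ |z a| := sq_le_sq.1 h2
  have h4 : |y a| * |r * y a| ≤ |y a| * |z a| := by gcongr
  rw [← abs_mul, ← abs_mul, abs_of_nonpos h0] at h4
  have h5 := le_abs_self (y a * (r * y a))
  linarith

lemma sq_le_of_potential_nonpos (h : IsLegendreSystem L m y z) {a b : ℝ} (ha : 0 ≤ a)
    (hab : a ≤ b) (hb : b ≤ 1) (hQ : L * (1 - a^2) - m^2 ≤ 0) : y b^2 ≤ y a^2 := by
  have hy := h.cont_y_on ha hb
  refine le_of_weighted_deriv_nonpos (F := fun x => y x^2)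
    (F' := fun x => 2 * (y x * z x)) ha hab hb (by fun_prop) ?_ ?_
  · intro x hx
    refine ((h.deriv_y x (mem_unit ha hb hx)).pow 2).congr_deriv ?_
    simp
    ring
  · intro x hx
    have hx' := mem_unit ha hb hx
    have := h.mul_nonpos_of_potential_nonpos hx'.1.le hx'.2.le
      (h.potential_nonpos_of_le ha hx.1.le hQ)
    linarith

lemma pow_four_mul_le (h : IsLegendreSystem L m y z) {a b r : ℝ} (ha : 0 ≤ a)
    (hab : a ≤ b) (hb : b ≤ 1) (hm : 0 < m) (hr : 0 ≤ r) (hr3 : m^2 ≤ 2 * r^3)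
    (hQ : r^2 ≤ m^2 - L * (1 - a^2)) :
    y b^4 * (m^2 - L * (1 - b^2)) ≤ y a^4 * (m^2 - L * (1 - a^2)) := by
  have hL := h.L_pos
  have hy := h.cont_y_on ha hb
  refine le_of_weighted_deriv_nonpos (F := fun x => y x^4 * (m^2 - L * (1 - x^2)))
    (F' := fun x => y x^2 * (4 * (m^2 - L * (1 - x^2)) * (y x * z x) +
      2 * x * (L * (1 - x^2)) * y x^2)) ha hab hb (by fun_prop) ?_ ?_
  · intro x hx
    have h1 := one_sub_sq_pos ha hb hx
    have := ((h.deriv_y x (mem_unit ha hb hx)).pow 4).mul (hasDerivAt_potential L m x).neg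
    have e : (fun x => y x^4 * (m^2 - L * (1 - x^2))) =
      (y ^ 4 * -fun x => L * (1 - x^2) - m^2) := by
      ext x; simp
    rw [e]
    refine this.congr_deriv ?_
    simp
    field_simp
  · intro x hx
    have h1 := one_sub_sq_pos ha hb hx
    have hx' := mem_unit ha hb hx
    have hR : r^2 ≤ m^2 - L * (1 - x^2) := by
      have : a^2 ≤ x^2 := by have := hx.1; gcongr
      nlinarith
    have h2 := h.mul_le_of_potential_nonpos hx'.1.le hx'.2.le hR hm
    have h3 : 0 ≤ m^2 - L * (1 - x^2) := (sq_nonneg r).trans hR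
    have h4 : x * (L * (1 - x^2)) ≤ 1 * m^2 := by
      have : 0 ≤ L * (1 - x^2) := by positivity
      gcongr
      · exact hx'.2.le
      · linarith
    have h5 : r^2 * (r * y x^2) ≤ (m^2 - L * (1 - x^2)) * (r * y x^2) := by gcongr
    have h6 := mul_le_mul_of_nonneg_left h2 h3
    have h7 := mul_le_mul_of_nonneg_right h4 (sq_nonneg (y x))
    have h8 := mul_le_mul_of_nonneg_right hr3 (sq_nonneg (y x))
    refine mul_nonpos_of_nonneg_of_nonpos (sq_nonneg _) ?_
    nlinarith

lemma pow_eight_div_le {k : ℕ} (h : IsLegendreSystem L k y z) {a b : ℝ} (ha : 0 ≤ a)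
    (hab : a ≤ b) (hb : b < 1) (hk : 0 < k) (hQ : L * (1 - a^2) ≤ 7 / 16 * (k:ℝ)^2) :
    y b^8 / (1 - b^2)^(3 * k) ≤ y a^8 / (1 - a^2)^(3 * k) := by
  have hL := h.L_pos
  have hy := h.cont_y_on ha hb.le
  have hk' : (0:ℝ) < k := by exact_mod_cast hk
  have hne : ∀ x ∈ Icc a b, (1 - x^2)^(3 * k) ≠ 0 := fun x hx => by
    have := hx.1; have := hx.2
    apply pow_ne_zero
    nlinarith
  refine le_of_weighted_deriv_nonpos (F := fun x => y x^8 / (1 - x^2)^(3 * k))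
    (F' := fun x => y x^6 / (1 - x^2)^(3 * k) * (8 * (y x * z x) + 6 * k * x * y x^2))
    ha hab hb.le (by fun_prop (disch := assumption)) ?_ ?_
  · intro x hx
    have h1 := one_sub_sq_pos ha hb.le hx
    have d1 : HasDerivAt (fun x : ℝ => 1 - x^2) (-(2 * x)) x := by
      simpa using hasDerivAt_potential 1 0 x
    have := ((h.deriv_y x (mem_unit ha hb.le hx)).pow 8).div (d1.pow (3 * k))
      (pow_ne_zero _ h1.ne')
    refine this.congr_deriv ?_
    obtain ⟨j, rfl⟩ : ∃ j, k = j + 1 := ⟨k - 1, by omega⟩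
    simp
    rw [show 3 * (j + 1) - 1 = 3 * j + 2 by omega, show 3 * (j + 1) = 3 * j + 3 by ring]
    field_simp
    ring
  · intro x hx
    have h1 := one_sub_sq_pos ha hb.le hx
    have hx' := mem_unit ha hb.le hx
    have hR : (3 / 4 * (k:ℝ))^2 ≤ (k:ℝ)^2 - L * (1 - x^2) := by
      have : a^2 ≤ x^2 := by have := hx.1; gcongr
      nlinarith
    have h2 := h.mul_le_of_potential_nonpos hx'.1.le hx'.2.le hR hk'
    have h3 : x * (k * y x^2) ≤ 1 * (k * y x^2) := by
      gcongr
      exact hx'.2.le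
    refine mul_nonpos_of_nonneg_of_nonpos (by positivity) ?_
    nlinarith

lemma abs_le_of_zero (h : IsLegendreSystem L 0 y z) {a b : ℝ} (ha : 0 < a)
    (hab : a ≤ b) (hb : b ≤ 1) (hQ : L * (1 - a^2) = 1) : |y b| ≤ 2 / a * |y a| := by
  have hL := h.L_pos
  have ha1 : a ≤ 1 := hab.trans hb
  have hy := h.cont_y_on ha.le le_rfl
  obtain ⟨c, hc, hmax⟩ := isCompact_Icc.exists_isMaxOn (nonempty_Icc.2 ha1) hy.abs
  have hB : ∀ x ∈ Icc a 1, |y x| ≤ |y c| := fun x hx => hmax hx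
  set B := |y c| with hBdef
  have hB0 : 0 ≤ B := abs_nonneg _
  have hz : ∀ x ∈ Ioo a c, ∀ s : ℝ, |s| = 1 → s * z x ≤ L * B * (1 - x) := by
    intro x hx s hs
    have hx0 : 0 ≤ x := ha.le.trans hx.1.le
    have hx1 : x ≤ 1 := hx.2.le.trans hc.2
    have hzc := h.cont_z_on hx0 le_rfl
    have := le_of_weighted_deriv_nonpos (F := fun t => -(s * z t + L * B * t))
      (F' := fun t => -((1 - t^2) * L * (B - s * y t))) hx0 hx1 le_rfl (by fun_prop) ?_ ?_
    · simp only [h.z_one] at this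
      linarith
    · intro t ht
      have h1 := one_sub_sq_pos hx0 le_rfl ht
      refine (((h.deriv_z t (mem_unit hx0 le_rfl ht)).const_mul s).add
        ((hasDerivAt_id t).const_mul (L * B))).neg.congr_deriv ?_
      field_simp
      ring
    · intro t ht
      have h1 := one_sub_sq_pos hx0 le_rfl ht
      have h2 : s * y t ≤ B := by
        refine (le_abs_self _).trans ?_
        rw [abs_mul, hs, one_mul]
        exact hB t ⟨hx.1.le.trans ht.1.le, ht.2.le⟩
      have h3 : 0 ≤ B - s * y t := by linarith
      simp only [Left.neg_nonpos_iff]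
      positivity
  have hs : ∀ s : ℝ, |s| = 1 → s * y c - L * B * c ≤ s * y a - L * B * a := by
    intro s hs
    have hyc := h.cont_y_on ha.le hc.2
    refine le_of_weighted_deriv_nonpos (F := fun x => s * y x - L * B * x)
      (F' := fun x => s * z x - L * B * (1 - x^2)) ha.le hc.1 hc.2 (by fun_prop) ?_ ?_
    · intro x hx
      have h1 := one_sub_sq_pos ha.le hc.2 hx
      refine (((h.deriv_y x (mem_unit ha.le hc.2 hx)).const_mul s).sub
        ((hasDerivAt_id x).const_mul (L * B))).congr_deriv ?_
      field_simp
    · intro x hx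
      have h2 := hz x hx s hs
      have hx' := mem_unit ha.le hc.2 hx
      have h3 : L * B * (1 - x) ≤ L * B * (1 - x^2) := by
        have := hx'.1
        have := hx'.2
        gcongr
        nlinarith
      linarith
  have hBa : B ≤ |y a| + L * B * (c - a) := by
    have hp := hs 1 (by simp)
    have hn := hs (-1) (by simp)
    rw [hBdef, abs_le]
    constructor
    · linarith [neg_abs_le (y a)]
    · linarith [le_abs_self (y a)]
  have h4 : L * B * (c - a) ≤ L * B * (1 - a) := by gcongr; exact hc.2
  have h5 : L * (1 - a) * (1 + a) = 1 := by linarith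
  have h6 : B * a ≤ 2 * |y a| := by
    have h7 : B * (1 + a) ≤ |y a| * (1 + a) + B := by
      calc B * (1 + a) ≤ (|y a| + L * B * (1 - a)) * (1 + a) := by gcongr; linarith
        _ = |y a| * (1 + a) + B * (L * (1 - a) * (1 + a)) := by ring
        _ = _ := by rw [h5, mul_one]
    have h8 : |y a| * (1 + a) ≤ |y a| * 2 := by gcongr; linarith
    linarith
  calc |y b| ≤ B := hB b ⟨hab, hb⟩
    _ = B * a / a := by field_simp
    _ ≤ 2 * |y a| / a := by gcongr
    _ = _ := by ring

lemma exists_level (h : IsLegendreSystem L m y z) {s : ℝ} (hs : 0 ≤ s) (hsL : s ≤ L) :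
    ∃ x ∈ Icc (0:ℝ) 1, L * (1 - x^2) = s := by
  have hL := h.L_pos
  have h1 : 0 ≤ 1 - s / L := by
    rw [sub_nonneg, div_le_one hL]
    exact hsL
  have h2 : 0 ≤ s / L := by positivity
  refine ⟨√(1 - s / L), ⟨Real.sqrt_nonneg _, Real.sqrt_le_one.2 (by linarith)⟩, ?_⟩
  rw [Real.sq_sqrt h1]
  field_simp
  ring

lemma le_of_level (h : IsLegendreSystem L m y z) {a b : ℝ} (hb : 0 ≤ b)
    (hab : L * (1 - b^2) ≤ L * (1 - a^2)) : a ≤ b := by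
  have := le_of_mul_le_mul_left hab h.L_pos
  exact le_of_sq_le_sq (by linarith) hb

lemma amplitude_le_of_initial (h : IsLegendreSystem L m y z) {lam κ a : ℝ} (hκ : 0 < κ)
    (hκ1 : κ ≤ 1) (ha : 0 ≤ a) (ha1 : a ≤ 1) (hlam : 1 ≤ lam) (hL : L ≤ lam^2)
    (hQ : κ / 4 * lam^2 ≤ L * (1 - a^2) - m^2)
    (hy : y a^2 ≤ 8 / κ^2) (hz : z a^2 ≤ 2 / κ * lam^2) :
    amplitude L m y z a ≤ 144 / κ^5 * lam := by
  have hL0 := h.L_pos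
  have hS : L * (1 - a^2) ≤ lam^2 := by nlinarith [mul_nonneg hL0.le (sq_nonneg a)]
  have hQ1 : L * (1 - a^2) - m^2 ≤ lam^2 := by nlinarith [sq_nonneg m]
  unfold amplitude
  have hS0 : 0 ≤ L * (1 - a^2) := by nlinarith [mul_nonneg hL0.le (sq_nonneg a)]
  generalize L * (1 - a^2) - m^2 = Q at *
  generalize L * (1 - a^2) = S at *
  generalize y a = Y at *
  generalize z a = Z at *
  have hQ0 : 0 < Q := lt_of_lt_of_le (by positivity) hQ
  have hq1 : √Q ≤ lam := (Real.sqrt_le_left (by linarith)).2 hQ1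
  have hq2 : κ / 2 * lam ≤ √Q := by
    apply Real.le_sqrt_of_sq_le
    refine le_trans ?_ hQ
    have : κ^2 ≤ κ := by nlinarith
    nlinarith [sq_nonneg lam]
  have hq0 : 0 < √Q := Real.sqrt_pos.2 hQ0
  have hSQ : a * S / (2 * Q) ≤ 2 / κ := by
    rw [div_le_div_iff₀ (by positivity) hκ]
    have : a * S ≤ 1 * lam^2 := by gcongr
    nlinarith
  have hSQ0 : 0 ≤ a * S / (2 * Q) := by positivity
  generalize a * S / (2 * Q) = u at *
  have h1 : (Z - u * Y)^2 ≤ 2 * Z^2 + 2 * (u^2 * Y^2) := by nlinarith [sq_nonneg (Z + u * Y)]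
  have h2 : 2 * Z^2 + 2 * (u^2 * Y^2) ≤ 2 * (2 / κ * lam^2) + 2 * ((2 / κ)^2 * (8 / κ^2)) := by
    gcongr
  have h3 : 2 * (2 / κ * lam^2) + 2 * ((2 / κ)^2 * (8 / κ^2)) ≤ 68 / κ^4 * lam^2 := by
    have e1 : 2 * (2 / κ * lam^2) = 4 * lam^2 * κ^3 / κ^4 := by field_simp; ring
    have e2 : 2 * ((2 / κ)^2 * (8 / κ^2)) = 64 * 1 / κ^4 := by field_simp; ring
    have e3 : 68 / κ^4 * lam^2 = (4 * lam^2 * 1 + 64 * lam^2) / κ^4 := by field_simp; ring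
    rw [e1, e2, e3, add_div]
    gcongr
    · exact pow_le_one₀ hκ.le hκ1
    · nlinarith
  have h4 : (Z - u * Y)^2 / √Q ≤ 136 / κ^5 * lam := by
    calc (Z - u * Y)^2 / √Q ≤ (68 / κ^4 * lam^2) / (κ / 2 * lam) := by gcongr; linarith
      _ = _ := by field_simp; ring
  have h5 : √Q * Y^2 ≤ 8 / κ^5 * lam := by
    calc √Q * Y^2 ≤ lam * (8 / κ^2) := by gcongr
      _ = 8 / κ^5 * lam * κ^3 := by field_simp
      _ ≤ 8 / κ^5 * lam * 1 := by gcongr; exact pow_le_one₀ hκ.le hκ1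
      _ = _ := by ring
  calc _ ≤ 8 / κ^5 * lam + 136 / κ^5 * lam := add_le_add h5 h4
    _ = _ := by ring

lemma le_amplitude (h : IsLegendreSystem L m y z) {a G : ℝ} (ha : 0 ≤ a) (ha1 : a ≤ 1)
    (hQ : 1 ≤ L * (1 - a^2) - m^2) (hQ3 : m^4 ≤ (L * (1 - a^2) - m^2)^3)
    (hE : amplitude L m y z a ≤ G) :
    √(L * (1 - a^2) - m^2) * y a^2 ≤ G ∧ z a^2 ≤ 4 * √(L * (1 - a^2) - m^2) * G := by
  have hL0 := h.L_pos
  unfold amplitude at hE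
  have hq1 : 1 ≤ √(L * (1 - a^2) - m^2) := Real.one_le_sqrt.2 hQ
  have hsq : √(L * (1 - a^2) - m^2) ^ 2 = L * (1 - a^2) - m^2 := Real.sq_sqrt (by linarith)
  have hS0 : 0 ≤ L * (1 - a^2) := by nlinarith [sq_nonneg m]
  have hm : m^2 ≤ √(L * (1 - a^2) - m^2)^3 := by
    rw [← hsq] at hQ3
    refine le_of_sq_le_sq ?_ (by positivity)
    nlinarith
  generalize √(L * (1 - a^2) - m^2) = q at *
  rw [← hsq] at hE
  have hS : L * (1 - a^2) ≤ 2 * q^3 := by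
    nlinarith [mul_le_mul_of_nonneg_left hq1 (sq_nonneg q)]
  generalize L * (1 - a^2) = S at *
  generalize y a = Y at *
  generalize z a = Z at *
  have h1 : 0 ≤ (Z - a * S / (2 * q^2) * Y)^2 / q := by positivity
  have h2 : 0 ≤ q * Y^2 := by positivity
  refine ⟨by linarith, ?_⟩
  have h3 : (Z - a * S / (2 * q^2) * Y)^2 ≤ q * (G - q * Y^2) := by
    have : (Z - a * S / (2 * q^2) * Y)^2 / q ≤ G - q * Y^2 := by linarith
    rwa [div_le_iff₀' (by linarith)] at this
  have hu : a * S / (2 * q^2) ≤ q := by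
    rw [div_le_iff₀ (by positivity)]
    calc a * S ≤ 1 * (2 * q^3) := by gcongr
      _ = _ := by ring
  have hu0 : 0 ≤ a * S / (2 * q^2) := by positivity
  generalize a * S / (2 * q^2) = u at *
  have h4 : Z^2 ≤ 2 * (Z - u * Y)^2 + 2 * (u^2 * Y^2) := by nlinarith [sq_nonneg (Z - 2 * u * Y)]
  have h5 : u^2 * Y^2 ≤ q^2 * Y^2 := by gcongr
  have h6 : 0 ≤ q * (G - q * Y^2) := (sq_nonneg _).trans h3
  nlinarith

/-- The bound across the turning point and beyond, past the point `a` where the potential has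
decreased to `M`. -/
lemma pow_four_mul_le_of_level {k : ℕ} (h : IsLegendreSystem L k y z) {a₀ a x M H : ℝ}
    (hk : 0 < k) (ha₀ : 0 < a₀) (ha : a₀ ≤ a) (hax : a ≤ x) (hx : x ≤ 1) (hM0 : 0 < M)
    (hM : M^3 = (1 + k)^4) (hQ : L * (1 - a^2) - k^2 = M)
    (hy : √M * y a^2 ≤ H) (hz : z a^2 ≤ 4 * √M * H) :
    y x^4 * M ≤ (42 / a₀^2 * H)^2 := by
  have hL0 := h.L_pos
  have ha0 : 0 < a := ha₀.trans_le ha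
  have ha1 : a ≤ 1 := hax.trans hx
  have hq0 : 0 < √M := Real.sqrt_pos.2 hM0
  have hsq : √M^2 = M := Real.sq_sqrt hM0.le
  have hH : 0 ≤ H := le_trans (by positivity) hy
  have hk1 : (1:ℝ) ≤ k := by exact_mod_cast hk
  have hk0 : (0:ℝ) < k := by linarith
  have hMk : M^3 ≤ 16 * (k:ℝ)^4 := by
    rw [hM]
    calc (1 + (k:ℝ))^4 ≤ (2 * k)^4 := by gcongr; linarith
      _ = _ := by ring
  have hpos : ∀ x, a ≤ x → x ≤ 1 → 0 ≤ L * (1 - x^2) - (k:ℝ)^2 →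
      √M * y x^2 ≤ 42 / a₀^2 * H := by
    intro x hax hx hQx
    have hB : (L * (1 - a^2) - (k:ℝ)^2) * y a^2 + z a^2 ≤ √(5 * √M * H)^2 := by
      rw [Real.sq_sqrt (by positivity), hQ]
      have : √M * (√M * y a^2) ≤ √M * H := by gcongr
      nlinarith
    have h1 := h.abs_le_of_potential_nonneg ha0 hax hx hk0 hQx (Real.sqrt_nonneg _) hB
    rw [hQ] at h1
    have h2 : y x^2 ≤ 2 * y a^2 + 2 * (√(5 * √M * H) * M / (2 * a * k^2))^2 := by
      rw [← sq_abs (y x), ← sq_abs (y a)]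
      calc |y x|^2 ≤ (|y a| + √(5 * √M * H) * M / (2 * a * k^2))^2 := by gcongr
        _ ≤ _ := by nlinarith [sq_nonneg (|y a| - √(5 * √M * H) * M / (2 * a * k^2))]
    have h3 : √M * (√(5 * √M * H) * M / (2 * a * k^2))^2 ≤ 20 / a₀^2 * H := by
      rw [div_pow, mul_pow, Real.sq_sqrt (by positivity)]
      calc √M * (5 * √M * H * M^2 / (2 * a * k^2)^2) =
          √M^2 * (5 * H * M^2 / (4 * a^2 * k^4)) := by field_simp; ring
        _ = 5 * H / (4 * a^2) * (M^3 / k^4) := by rw [hsq]; field_simp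
        _ ≤ 5 * H / (4 * a₀^2) * 16 := by
          gcongr
          rw [div_le_iff₀ (by positivity)]
          exact hMk
        _ = _ := by field_simp; ring
    have h4 : 2 * H ≤ 2 / a₀^2 * H := by
      have : 1 ≤ 1 / a₀^2 := by
        rw [one_le_div (by positivity)]
        nlinarith
      calc 2 * H = 2 * 1 * H := by ring
        _ ≤ 2 * (1 / a₀^2) * H := by gcongr
        _ = _ := by ring
    calc √M * y x^2 ≤ √M * (2 * y a^2 + 2 * (√(5 * √M * H) * M / (2 * a * k^2))^2) := by gcongr
      _ = 2 * (√M * y a^2) + 2 * (√M * (√(5 * √M * H) * M / (2 * a * k^2))^2) := by ring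
      _ ≤ 2 / a₀^2 * H + 2 * (20 / a₀^2 * H) := by linarith
      _ = _ := by ring
  obtain ⟨t, ht, hQt⟩ := h.exists_level (s := (k:ℝ)^2) (by positivity)
    (by nlinarith [mul_nonneg hL0.le (sq_nonneg a)])
  have hat : a ≤ t := h.le_of_level ht.1 (by linarith)
  have h1 : √M * y x^2 ≤ 42 / a₀^2 * H := by
    rcases le_total 0 (L * (1 - x^2) - (k:ℝ)^2) with hQx | hQx
    · exact hpos x hax hx hQx
    · have htx : t ≤ x := h.le_of_level (ha0.le.trans hax) (by linarith)
      have := h.sq_le_of_potential_nonpos ht.1 htx hx (by linarith)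
      exact (mul_le_mul_of_nonneg_left this hq0.le).trans (hpos t hat ht.2 (by linarith))
  calc y x^4 * M = (√M * y x^2)^2 := by rw [mul_pow, hsq]; ring
    _ ≤ _ := by gcongr

/-- The bound past the point `a` where the potential has decreased to `M`. -/
lemma pow_four_mul_add_le_of_level {k : ℕ} (h : IsLegendreSystem L k y z) {a₀ a b M H : ℝ}
    (ha₀ : 0 < a₀) (ha : a₀ ≤ a) (hab : a ≤ b) (hb : b ≤ 1) (hM0 : 0 < M)
    (hM : M^3 = (1 + k)^4) (hQ : L * (1 - a^2) - k^2 = M)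
    (hy : √M * y a^2 ≤ H) (hz : z a^2 ≤ 4 * √M * H) :
    y b^4 * (M + |L * (1 - b^2) - k^2|) ≤ 4000 * H^2 / a₀^4 := by
  have hL0 := h.L_pos
  have ha0 : 0 < a := ha₀.trans_le ha
  have ha1 : a ≤ 1 := hab.trans hb
  have hq0 : 0 < √M := Real.sqrt_pos.2 hM0
  have hsq : √M^2 = M := Real.sq_sqrt hM0.le
  have hH : 0 ≤ H := le_trans (by positivity) hy
  have hyM : y a^4 * M ≤ H^2 := by
    calc y a^4 * M = (√M * y a^2)^2 := by rw [mul_pow, hsq]; ring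
      _ ≤ H^2 := by gcongr
  have hmono : ∀ x, a ≤ x → L * (1 - x^2) - k^2 ≤ M := by
    intro x hx
    rw [← hQ]
    gcongr
  rcases Nat.eq_zero_or_pos k with rfl | hk
  · have hM1 : M = 1 := by
      have : M^3 = 1 := by simpa using hM
      exact (pow_eq_one_iff_of_nonneg hM0.le (by norm_num)).1 this
    subst hM1
    simp only [Nat.cast_zero] at *
    have h1 := h.abs_le_of_zero ha0 hab hb (by linarith)
    have h2 : y b^4 ≤ 16 / a₀^4 * y a^4 := by
      calc y b^4 = |y b|^4 := by rw [pow_abs, abs_of_nonneg (by positivity)]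
        _ ≤ (2 / a * |y a|)^4 := by gcongr
        _ = (2 / a)^4 * y a^4 := by
          rw [mul_pow, pow_abs, abs_of_nonneg (by positivity : 0 ≤ y a^4)]
        _ ≤ (2 / a₀)^4 * y a^4 := by gcongr
        _ = _ := by ring
    have h3 : |L * (1 - b^2) - (0:ℝ)^2| ≤ 1 := by
      have : 0 ≤ L * (1 - b^2) := by
        have : b^2 ≤ 1 := by nlinarith
        exact mul_nonneg hL0.le (by linarith)
      rw [abs_of_nonneg (by simpa using this)]
      exact hmono b hab
    calc y b^4 * (1 + |L * (1 - b^2) - (0:ℝ)^2|) ≤ (16 / a₀^4 * y a^4) * (1 + 1) := by gcongr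
      _ = 32 / a₀^4 * (y a^4 * 1) := by ring
      _ ≤ 4000 / a₀^4 * H^2 := by gcongr; norm_num
      _ = _ := by ring
  · have hk0 : (0:ℝ) < k := by exact_mod_cast hk
    have hall : ∀ x, a ≤ x → x ≤ 1 → y x^4 * M ≤ (42 / a₀^2 * H)^2 := fun x hax hx =>
      h.pow_four_mul_le_of_level hk ha₀ ha hax hx hM0 hM hQ hy hz
    have hfin : y b^4 * (M + |L * (1 - b^2) - (k:ℝ)^2|) ≤ 2 * (42 / a₀^2 * H)^2 := by
      rcases le_or_gt (-M) (L * (1 - b^2) - (k:ℝ)^2) with hc | hc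
      · have hc' := abs_le.2 ⟨hc, hmono b hab⟩
        calc y b^4 * (M + |L * (1 - b^2) - (k:ℝ)^2|) ≤ y b^4 * (M + M) := by gcongr
          _ = 2 * (y b^4 * M) := by ring
          _ ≤ _ := by gcongr; exact hall b hab hb
      · have hS : 0 ≤ L * (1 - b^2) := mul_nonneg hL0.le (by nlinarith)
        have hLa : L * (1 - a^2) ≤ L := by nlinarith [mul_nonneg hL0.le (sq_nonneg a)]
        rw [abs_of_neg (by linarith)]
        obtain ⟨s, hs, hQs⟩ := h.exists_level (s := (k:ℝ)^2 - M) (by linarith) (by linarith)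
        have has : a ≤ s := h.le_of_level hs.1 (by linarith)
        have hsb : s ≤ b := h.le_of_level (ha0.le.trans hab) (by linarith)
        have hq3 : (k:ℝ)^2 ≤ 2 * √M^3 := by
          have h1 : (√M^3)^2 = ((1 + (k:ℝ))^2)^2 := by
            calc (√M^3)^2 = (√M^2)^3 := by ring
              _ = ((1 + (k:ℝ))^2)^2 := by rw [hsq, hM]; ring
          rw [(sq_eq_sq₀ (by positivity) (by positivity)).1 h1]
          nlinarith
        have h1 := h.pow_four_mul_le hs.1 hsb hb hk0 hq0.le hq3 (by rw [hsq]; linarith)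
        rw [hQs, sub_sub_cancel] at h1
        have h2 := hall s has hs.2
        calc y b^4 * (M + -(L * (1 - b^2) - (k:ℝ)^2))
            ≤ y b^4 * ((k^2 - L * (1 - b^2)) + (k^2 - L * (1 - b^2))) := by gcongr <;> linarith
          _ = 2 * (y b^4 * (k^2 - L * (1 - b^2))) := by ring
          _ ≤ _ := by gcongr; exact h1.trans h2
    refine hfin.trans ?_
    calc 2 * (42 / a₀^2 * H)^2 = 3528 * H^2 / a₀^4 := by field_simp; ring
      _ ≤ _ := by gcongr; norm_num

/-- The constant in the uniform bound for Legendre systems. -/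
def uniformConst (κ : ℝ) : ℝ :=
  128 / κ^4 + 4000 * (144 / κ^5 * Real.exp (9 / (2 * √(κ / 2))))^2 / √(κ / 2)^4

lemma uniformConst_pos {κ : ℝ} (hκ : 0 < κ) : 0 < uniformConst κ := by
  unfold uniformConst
  have : 0 < √(κ / 2) := Real.sqrt_pos.2 (by linarith)
  positivity

lemma level_le {κ lam M k : ℝ} (hκ : 0 < κ) (hk : 0 ≤ k)
    (hk1 : 1 + k ≤ 2 * lam) (hbig : 1024 ≤ lam^2 * κ^3) (hM : M^3 = (1 + k)^4) :
    M ≤ κ / 4 * lam^2 := by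
  refine le_of_pow_le_pow_left₀ (n := 3) (by norm_num) (by positivity) ?_
  rw [hM]
  calc (1 + k)^4 ≤ (2 * lam)^4 := by gcongr
    _ = lam^4 / 64 * 1024 := by ring
    _ ≤ lam^4 / 64 * (lam^2 * κ^3) := by gcongr
    _ = _ := by ring

lemma one_le_level {M k : ℝ} (hM0 : 0 < M) (hk : 0 ≤ k) (hM : M^3 = (1 + k)^4) : 1 ≤ M := by
  refine le_of_pow_le_pow_left₀ (n := 3) (by norm_num) hM0.le ?_
  rw [hM, one_pow]
  exact one_le_pow₀ (by linarith)

lemma potential_lower_bound {κ lam L k : ℝ} (hκ : 0 < κ) (hκ1 : κ ≤ 1)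
    (hL : lam^2 = L + 1 / 4) (hk : k^2 ≤ (1 - κ) * lam^2) (hbig : 1024 ≤ lam^2 * κ^3) :
    κ / 4 * lam^2 ≤ L * (1 - κ / 2) - k^2 := by
  have hκ3 : κ^3 ≤ κ := by
    have : κ^2 ≤ 1 := pow_le_one₀ hκ.le hκ1
    nlinarith
  have : 1 ≤ lam^2 * κ := by nlinarith [mul_le_mul_of_nonneg_left hκ3 (sq_nonneg lam)]
  have hL' : L = lam^2 - 1 / 4 := by linarith
  rw [hL']
  nlinarith

lemma energy_le_of_initial (h : IsLegendreSystem L m y z) {lam κ t : ℝ} (hL : L ≤ lam^2)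
    (hy0 : y 0^2 ≤ 1 / κ) (hz0 : z 0^2 ≤ lam^2 / κ) (ht : t ∈ Icc (0:ℝ) 1) :
    (L * (1 - t^2) - m^2) * y t^2 + z t^2 ≤ 2 / κ * lam^2 := by
  refine (h.energy_le le_rfl ht.1 ht.2).trans ?_
  have h1 : (L * (1 - 0^2) - m^2) * y 0^2 ≤ lam^2 * (1 / κ) := by
    gcongr
    nlinarith [sq_nonneg m]
  calc _ ≤ lam^2 * (1 / κ) + lam^2 / κ := add_le_add h1 hz0
    _ = _ := by ring

lemma sq_le_of_initial (h : IsLegendreSystem L m y z) {lam κ t : ℝ} (hκ : 0 < κ)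
    (hlam : 1 ≤ lam) (hL : L ≤ lam^2) (hy0 : y 0^2 ≤ 1 / κ) (hz0 : z 0^2 ≤ lam^2 / κ)
    (ht : t ∈ Icc (0:ℝ) 1) (hQ : κ / 4 * lam^2 ≤ L * (1 - t^2) - m^2) : y t^2 ≤ 8 / κ^2 := by
  have h1 := h.energy_le_of_initial hL hy0 hz0 ht
  have h3 : κ / 4 * lam^2 * y t^2 ≤ 2 / κ * lam^2 := by
    nlinarith [mul_le_mul_of_nonneg_right hQ (sq_nonneg (y t)), sq_nonneg (z t)]
  have h4 : κ / 4 * lam^2 * (8 / κ^2) = 2 / κ * lam^2 := by field_simp; ring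
  rw [← h4] at h3
  exact le_of_mul_le_mul_left h3 (by positivity)

theorem pow_four_mul_add_le {k : ℕ} (h : IsLegendreSystem L k y z) {lam κ x M : ℝ} (hκ : 0 < κ)
    (hκ1 : κ ≤ 1) (hlam : 1 ≤ lam) (hL : lam^2 = L + 1 / 4) (hk : (k:ℝ)^2 ≤ (1 - κ) * lam^2)
    (hk1 : 1 + (k:ℝ) ≤ 2 * lam) (hbig : 1024 ≤ lam^2 * κ^3) (hM0 : 0 < M)
    (hM : M^3 = (1 + k)^4) (hy0 : y 0^2 ≤ 1 / κ) (hz0 : z 0^2 ≤ lam^2 / κ)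
    (hx : x ∈ Icc (0:ℝ) 1) :
    y x^4 * (M + |L * (1 - x^2) - (k:ℝ)^2|) ≤ uniformConst κ * lam^2 := by
  have hL0 := h.L_pos
  have hlam2 : 1 ≤ lam^2 := one_le_pow₀ hlam
  set a := √(κ / 2) with ha_def
  have ha0 : 0 < a := Real.sqrt_pos.2 (by linarith)
  have hasq : a^2 = κ / 2 := Real.sq_sqrt (by linarith)
  have ha1 : a ≤ 1 := Real.sqrt_le_one.2 (by linarith)
  have hLlam : L ≤ lam^2 := by linarith
  have hk0 : (0:ℝ) ≤ k := Nat.cast_nonneg k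
  have hQa : κ / 4 * lam^2 ≤ L * (1 - a^2) - (k:ℝ)^2 := by
    rw [hasq]
    exact potential_lower_bound hκ hκ1 hL hk hbig
  have hM1 : 1 ≤ M := one_le_level hM0 hk0 hM
  have hMlam : M ≤ κ / 4 * lam^2 := level_le hκ hk0 hk1 hbig hM
  have hbefore : ∀ t ∈ Icc (0:ℝ) a, κ / 4 * lam^2 ≤ L * (1 - t^2) - (k:ℝ)^2 := by
    intro t ht
    have : t^2 ≤ a^2 := by have := ht.2; have := ht.1; gcongr
    nlinarith
  have hQle : L * (1 - x^2) - (k:ℝ)^2 ≤ lam^2 := by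
    nlinarith [mul_nonneg hL0.le (sq_nonneg x), sq_nonneg (k:ℝ)]
  set G := 144 / κ^5 * Real.exp (9 / (2 * a)) with hG
  have hG0 : 0 < G := by positivity
  have hc1 : 128 / κ^4 ≤ uniformConst κ := by
    unfold uniformConst
    linarith [show 0 ≤ 4000 * G^2 / a^4 by positivity]
  have hc2 : 4000 * G^2 / a^4 ≤ uniformConst κ := by
    unfold uniformConst
    linarith [show 0 ≤ 128 / κ^4 by positivity]
  rcases le_total x a with hxa | hxa
  · refine le_trans ?_ (mul_le_mul_of_nonneg_right hc1 (sq_nonneg lam))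
    have hQx := hbefore x ⟨hx.1, hxa⟩
    have hy := h.sq_le_of_initial hκ hlam hLlam hy0 hz0 hx hQx
    rw [abs_of_nonneg (le_trans (by positivity) hQx)]
    calc y x^4 * (M + (L * (1 - x^2) - (k:ℝ)^2))
        = (y x^2)^2 * (M + (L * (1 - x^2) - (k:ℝ)^2)) := by ring
      _ ≤ (8 / κ^2)^2 * (lam^2 + lam^2) := by
        gcongr
        · linarith [mul_nonneg hκ.le (sq_nonneg lam)]
        · linarith
      _ = _ := by ring
  refine le_trans ?_ (mul_le_mul_of_nonneg_right hc2 (sq_nonneg lam))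
  have hEa : amplitude L k y z a ≤ 144 / κ^5 * lam := by
    refine h.amplitude_le_of_initial hκ hκ1 ha0.le ha1 hlam hLlam hQa
      (h.sq_le_of_initial hκ hlam hLlam hy0 hz0 ⟨ha0.le, ha1⟩ hQa) ?_
    have h1 := h.energy_le_of_initial hLlam hy0 hz0 ⟨ha0.le, ha1⟩
    have h2 : 0 ≤ (L * (1 - a^2) - (k:ℝ)^2) * y a^2 :=
      mul_nonneg (le_trans (by positivity) hQa) (sq_nonneg _)
    linarith
  have hM4 : (k:ℝ)^4 ≤ M^3 := by
    rw [hM]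
    gcongr
    linarith
  have hE : ∀ t, a ≤ t → t ≤ 1 → M ≤ L * (1 - t^2) - (k:ℝ)^2 →
      √(L * (1 - t^2) - (k:ℝ)^2) * y t^2 ≤ G * lam ∧
        z t^2 ≤ 4 * √(L * (1 - t^2) - (k:ℝ)^2) * (G * lam) := by
    intro t hat ht hQt
    have hQ3 : (k:ℝ)^4 ≤ (L * (1 - t^2) - (k:ℝ)^2)^3 := hM4.trans (by gcongr)
    refine h.le_amplitude (ha0.le.trans hat) ht (hM1.trans hQt) hQ3 ?_
    refine (h.amplitude_le ha0 hat ht (hM1.trans hQt) hQ3).trans ?_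
    calc _ ≤ (144 / κ^5 * lam) * Real.exp (9 / (2 * a)) := by gcongr
      _ = G * lam := by rw [hG]; ring
  rcases le_total M (L * (1 - x^2) - (k:ℝ)^2) with hQx | hQx
  · have h1 := (hE x hxa hx.2 hQx).1
    have hQ0 : 0 ≤ L * (1 - x^2) - (k:ℝ)^2 := hM0.le.trans hQx
    rw [abs_of_nonneg hQ0]
    have hsq : √(L * (1 - x^2) - (k:ℝ)^2)^2 = L * (1 - x^2) - (k:ℝ)^2 := Real.sq_sqrt hQ0
    have ha4 : 2 ≤ 4000 / a^4 := by
      rw [le_div_iff₀ (by positivity)]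
      have : a^4 ≤ 1 := pow_le_one₀ ha0.le ha1
      linarith
    calc y x^4 * (M + (L * (1 - x^2) - (k:ℝ)^2))
        ≤ y x^4 * ((L * (1 - x^2) - (k:ℝ)^2) + (L * (1 - x^2) - (k:ℝ)^2)) := by gcongr
      _ = 2 * (√(L * (1 - x^2) - (k:ℝ)^2) * y x^2)^2 := by rw [mul_pow, hsq]; ring
      _ ≤ 4000 / a^4 * (G * lam)^2 := by gcongr
      _ = _ := by ring
  · obtain ⟨t, ht, hQt⟩ := h.exists_level (s := (k:ℝ)^2 + M) (by positivity)
      (by nlinarith [mul_nonneg hL0.le (sq_nonneg a)])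
    have hat : a ≤ t := h.le_of_level ht.1 (by linarith)
    have htx : t ≤ x := h.le_of_level hx.1 (by linarith)
    have hQt' : L * (1 - t^2) - (k:ℝ)^2 = M := by linarith
    have h1 := hE t hat ht.2 hQt'.ge
    rw [hQt'] at h1
    refine (h.pow_four_mul_add_le_of_level ha0 hat htx hx.2 hM0 hM hQt' h1.1 h1.2).trans_eq ?_
    ring

/-- Exponential decay deep in the classically forbidden region. -/
theorem abs_mul_two_pow_le {k : ℕ} (h : IsLegendreSystem L k y z) {a x : ℝ} (ha0 : 0 ≤ a)
    (hx0 : 0 ≤ x) (hx1 : x ≤ 1) (hk : 0 < k) (hQa : L * (1 - a^2) = 7 / 16 * (k:ℝ)^2)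
    (hQx : L * (1 - x^2) ≤ 1 / 16 * (k:ℝ)^2) : |y x| * 2^k ≤ |y a| := by
  have hL0 := h.L_pos
  have hk0 : (0:ℝ) < k := by exact_mod_cast hk
  have hax : a ≤ x := h.le_of_level hx0 (by nlinarith)
  rcases hx1.lt_or_eq with hx1 | rfl
  swap
  · have hy1 : y 1 = 0 := by simpa [hk.ne'] using h.y_one
    simp [hy1]
  have h1 := h.pow_eight_div_le ha0 hax hx1 hk hQa.le
  have hxp : 0 < 1 - x^2 := by nlinarith
  have hap : 0 < 1 - a^2 := by nlinarith
  have h7 : 7 * (1 - x^2) ≤ 1 - a^2 := by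
    refine le_of_mul_le_mul_left ?_ hL0
    nlinarith
  have h2 : y x^8 * (2^k)^8 ≤ y a^8 := by
    rw [div_le_div_iff₀ (by positivity) (by positivity)] at h1
    have h3 : (2:ℝ)^(8 * k) * (1 - x^2)^(3 * k) ≤ (1 - a^2)^(3 * k) := by
      calc (2:ℝ)^(8 * k) * (1 - x^2)^(3 * k) = (256 * (1 - x^2)^3)^k := by
            rw [mul_pow, pow_mul, pow_mul]; norm_num
        _ ≤ ((1 - a^2)^3)^k := by
          gcongr
          calc 256 * (1 - x^2)^3 ≤ (7 * (1 - x^2))^3 := by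
                rw [mul_pow]; gcongr; norm_num
            _ ≤ _ := by gcongr
        _ = _ := by rw [pow_mul]
    have h4 : 0 ≤ y x^8 := by positivity
    refine le_of_mul_le_mul_right ?_ (pow_pos hxp (3 * k))
    calc y x^8 * (2^k)^8 * (1 - x^2)^(3 * k) = y x^8 * (2^(8 * k) * (1 - x^2)^(3 * k)) := by ring
      _ ≤ y x^8 * (1 - a^2)^(3 * k) := by gcongr
      _ ≤ _ := h1
  refine le_of_pow_le_pow_left₀ (n := 8) (by norm_num) (abs_nonneg _) ?_
  rw [mul_pow, pow_abs, pow_abs, abs_of_nonneg (by positivity), abs_of_nonneg (by positivity)]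
  exact h2

end IsLegendreSystem

section LegendreFunctions

open Polynomial

/-- The `k`-th derivative of `(x²-1)^n`. -/
def rodrigues (n k : ℕ) (x : ℝ) : ℝ := (derivative^[k] ((X^2 - 1)^n : ℝ[X])).eval x

lemma hasDerivAt_rodrigues (n k : ℕ) (x : ℝ) :
    HasDerivAt (rodrigues n k) (rodrigues n (k + 1) x) x := by
  unfold rodrigues
  rw [Function.iterate_succ_apply']
  exact Polynomial.hasDerivAt _ x

lemma continuous_rodrigues (n k : ℕ) : Continuous (rodrigues n k) :=
  Polynomial.continuous _

lemma iteratedDeriv_rodrigues (n k j : ℕ) :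
    iteratedDeriv j (rodrigues n k) = rodrigues n (k + j) := by
  induction j with
  | zero => simp
  | succ j ih =>
    rw [iteratedDeriv_succ, ih]
    ext x
    exact (hasDerivAt_rodrigues n (k + j) x).deriv

lemma legendreP_eq (n : ℕ) (x : ℝ) :
    legendreP n x = ((2:ℝ)^n * (n.factorial : ℝ))⁻¹ * rodrigues n n x := by
  have h : (fun y : ℝ => (y^2 - 1)^n) = rodrigues n 0 := by
    ext y; simp [rodrigues]
  rw [legendreP, h, iteratedDeriv_rodrigues, zero_add]

lemma iteratedDeriv_legendreP (n m : ℕ) (x : ℝ) :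
    iteratedDeriv m (legendreP n) x =
      ((2:ℝ)^n * (n.factorial : ℝ))⁻¹ * rodrigues n (n + m) x := by
  rw [funext (legendreP_eq n), iteratedDeriv_const_mul_field, iteratedDeriv_rodrigues]

lemma rodrigues_ode (n k : ℕ) (x : ℝ) :
    (x^2 - 1) * rodrigues n (k + 2) x + 2 * (k + 1 - n) * x * rodrigues n (k + 1) x +
      (k + 1) * (k - 2 * n) * rodrigues n k x = 0 := by
  have key : ∀ k : ℕ, ((X:ℝ[X])^2 - 1) * derivative^[k + 2] ((X^2 - 1)^n) +
      C (2 * ((k:ℝ) + 1 - n)) * X * derivative^[k + 1] ((X^2 - 1)^n) +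
      C (((k:ℝ) + 1) * (k - 2 * n)) * derivative^[k] ((X^2 - 1)^n) = 0 := by
    intro k
    induction k with
    | zero =>
      have h0 : ((X:ℝ[X])^2 - 1) * derivative ((X^2 - 1)^n) = C (2 * (n:ℝ)) * X * (X^2 - 1)^n := by
        rcases n with _ | n
        · simp
        · simp [derivative_pow]
          ring
      have h1 := congrArg derivative h0
      have hC : (C (2:ℝ) : ℝ[X]) = 2 := map_ofNat C 2
      simp [hC] at h1 ⊢
      linear_combination h1
    | succ k ih =>
      have h1 := congrArg derivative ih
      simp only [Function.iterate_succ_apply'] at h1 ⊢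
      have hC : (C (2:ℝ) : ℝ[X]) = 2 := map_ofNat C 2
      simp [hC] at h1 ⊢
      linear_combination h1
  have := congrArg (eval x) (key k)
  simpa [rodrigues] using this

lemma rodrigues_neg (n k : ℕ) (x : ℝ) : rodrigues n k (-x) = (-1)^k * rodrigues n k x := by
  have h : (fun y => rodrigues n 0 (-y)) = rodrigues n 0 := by
    ext y; simp [rodrigues]
  have h1 := iteratedDeriv_comp_neg k (rodrigues n 0) (-x)
  rw [h, iteratedDeriv_rodrigues] at h1
  simpa using h1

lemma rodrigues_zero (n k : ℕ) :
    rodrigues n k 0 = k.factorial * ((X^2 - 1)^n : ℝ[X]).coeff k := by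
  rw [rodrigues, ← coeff_zero_eq_eval_zero, coeff_iterate_derivative]
  simp [Nat.descFactorial_self]

lemma sq_sub_one_pow_eq_expand (n : ℕ) :
    ((X^2 - 1)^n : ℝ[X]) = expand ℝ 2 ((X + C (-1))^n) := by
  simp [sub_eq_add_neg]

lemma rodrigues_zero_of_odd {n k : ℕ} (hk : Odd k) : rodrigues n k 0 = 0 := by
  rw [rodrigues_zero, sq_sub_one_pow_eq_expand, coeff_expand (by norm_num),
    if_neg (by rwa [← even_iff_two_dvd, Nat.not_even_iff_odd])]
  simp

lemma rodrigues_zero_sq (p q : ℕ) :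
    rodrigues (p + q) (2 * p) 0^2 =
      ((2 * p).factorial * ((p + q).factorial / (p.factorial * q.factorial)))^2 := by
  rw [rodrigues_zero, sq_sub_one_pow_eq_expand, coeff_expand_mul' (by norm_num),
    coeff_X_add_C_pow, mul_pow, mul_pow, mul_pow, ← pow_mul, mul_comm (p + q - p) 2, pow_mul]
  rw [Nat.choose_symm_add, Nat.add_choose,
    Nat.cast_div (Nat.factorial_mul_factorial_dvd_factorial_add p q)
    (by positivity)]
  simp

/-- The central binomial coefficient divided by `4^p`. -/
def wallisRatio (p : ℕ) : ℝ := (2 * p).factorial / (4^p * p.factorial^2)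

lemma wallisRatio_sq_le (p : ℕ) : wallisRatio p^2 ≤ 1 / (2 * p + 1) := by
  induction p with
  | zero => simp [wallisRatio]
  | succ p ih =>
    have e : wallisRatio (p + 1) = wallisRatio p * ((2 * (p:ℝ) + 1) / (2 * p + 2)) := by
      unfold wallisRatio
      rw [show 2 * (p + 1) = 2 * p + 1 + 1 by ring, Nat.factorial_succ, Nat.factorial_succ,
        Nat.factorial_succ]
      push_cast
      field_simp
      ring
    rw [e, mul_pow]
    calc wallisRatio p^2 * ((2 * (p:ℝ) + 1) / (2 * p + 2))^2
        ≤ 1 / (2 * (p:ℝ) + 1) * ((2 * (p:ℝ) + 1) / (2 * p + 2))^2 := by gcongr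
      _ = (2 * (p:ℝ) + 1) / (2 * p + 2)^2 := by field_simp
      _ ≤ _ := by
        rw [div_le_div_iff₀ (by positivity) (by positivity)]
        push_cast
        nlinarith

/-- The normalising constant of `Ỹ_{n,k}` in terms of `rodrigues`. -/
def sphHarmonicConst (n k : ℕ) : ℝ :=
  √((2 * (n:ℝ) + 1) / (4 * Real.pi) * ((n - k).factorial / (n + k).factorial)) *
    ((2:ℝ)^n * (n.factorial : ℝ))⁻¹

lemma sphHarmonicConst_sq (n k : ℕ) : sphHarmonicConst n k^2 =
    (2 * (n:ℝ) + 1) / (4 * Real.pi) * ((n - k).factorial / (n + k).factorial) /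
      (4^n * (n.factorial : ℝ)^2) := by
  rw [sphHarmonicConst, mul_pow, Real.sq_sqrt (by positivity), inv_pow, mul_pow, ← pow_mul,
    mul_comm n 2, pow_mul]
  norm_num [div_eq_mul_inv]

/-- The function `Ỹ_{n,k}` up to sign, for `0 ≤ k`. -/
def sphHarmonic (n k : ℕ) (x : ℝ) : ℝ :=
  sphHarmonicConst n k * (√(1 - x^2)^k * rodrigues n (n + k) x)

/-- `(1-x²)` times the derivative of `sphHarmonic n k`. -/
def sphHarmonicDeriv (n k : ℕ) (x : ℝ) : ℝ :=
  sphHarmonicConst n k * (√(1 - x^2)^k *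
    ((1 - x^2) * rodrigues n (n + k + 1) x - k * x * rodrigues n (n + k) x))

lemma continuous_sphHarmonic (n k : ℕ) : Continuous (sphHarmonic n k) := by
  have := continuous_rodrigues n (n + k)
  unfold sphHarmonic
  fun_prop

lemma continuous_sphHarmonicDeriv (n k : ℕ) : Continuous (sphHarmonicDeriv n k) := by
  have := continuous_rodrigues n (n + k)
  have := continuous_rodrigues n (n + k + 1)
  unfold sphHarmonicDeriv
  fun_prop

lemma abs_sphHarmonic_abs (n k : ℕ) (x : ℝ) : |sphHarmonic n k (|x|)| = |sphHarmonic n k x| := by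
  rcases abs_choice x with h | h
  · rw [h]
  · rw [h]
    simp [sphHarmonic, rodrigues_neg, abs_mul]

lemma abs_tY (n : ℕ) (m : ℤ) (hm : m.natAbs ≤ n) (x : ℝ) :
    |tY n m x| = |sphHarmonic n m.natAbs x| := by
  have hc : ∀ k : ℕ, |assocP n k x| =
      √(1 - x^2)^k * (((2:ℝ)^n * (n.factorial : ℝ))⁻¹ * |rodrigues n (n + k) x|) := by
    intro k
    rw [assocP, iteratedDeriv_legendreP, abs_mul, abs_mul, abs_mul, abs_pow, abs_neg, abs_one,
      one_pow, one_mul, abs_of_nonneg (by positivity : (0:ℝ) ≤ √(1 - x^2)^k),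
      abs_of_nonneg (by positivity : (0:ℝ) ≤ ((2:ℝ)^n * (n.factorial : ℝ))⁻¹)]
  have hh : ∀ k : ℕ, |sphHarmonic n k x| =
      √((2 * (n:ℝ) + 1) / (4 * Real.pi) * ((n - k).factorial / (n + k).factorial)) *
        (√(1 - x^2)^k * (((2:ℝ)^n * (n.factorial : ℝ))⁻¹ * |rodrigues n (n + k) x|)) := by
    intro k
    rw [sphHarmonic, sphHarmonicConst, abs_mul, abs_mul, abs_mul,
      abs_of_nonneg (by positivity : (0:ℝ) ≤ √(1 - x^2)^k),
      abs_of_nonneg (by positivity : (0:ℝ) ≤ ((2:ℝ)^n * (n.factorial : ℝ))⁻¹),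
      abs_of_nonneg (Real.sqrt_nonneg _)]
    ring
  rw [hh, ← hc, tY, assocPZ, abs_mul, abs_of_nonneg (Real.sqrt_nonneg _)]
  rcases Int.eq_nat_or_neg m with ⟨k, rfl | rfl⟩
  · have h1 : ((n:ℤ) - k).toNat = n - k := by omega
    have h2 : ((n:ℤ) + k).toNat = n + k := by omega
    rw [if_pos (by positivity), h1, h2]
    simp
  · simp only [Int.natAbs_neg, Int.natAbs_natCast] at hm ⊢
    have h1 : ((n:ℤ) - -k).toNat = n + k := by omega
    have h2 : ((n:ℤ) + -k).toNat = n - k := by omega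
    rw [h1, h2]
    rcases Nat.eq_zero_or_pos k with rfl | hk
    · simp
    rw [if_neg (by omega), abs_mul, abs_mul, abs_pow, abs_neg, abs_one, one_pow, one_mul,
      ← mul_assoc, abs_of_nonneg (by positivity)]
    congr 1
    set r : ℝ := ((n - k).factorial : ℝ) / ((n + k).factorial : ℝ) with hr
    have hr0 : 0 < r := by positivity
    have h3 : ((n + k).factorial : ℝ) / ((n - k).factorial : ℝ) = r⁻¹ := by rw [hr, inv_div]
    rw [h3, Real.sqrt_mul (by positivity), Real.sqrt_mul (by positivity), Real.sqrt_inv, mul_assoc]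
    congr 1
    have : √r * √r = r := Real.mul_self_sqrt hr0.le
    have h4 : √r ≠ 0 := (Real.sqrt_pos.2 hr0).ne'
    field_simp
    linarith

lemma hasDerivAt_sqrt_one_sub_sq_pow (k : ℕ) {x : ℝ} (hx : 0 < 1 - x^2) :
    HasDerivAt (fun t => √(1 - t^2)^k) (-(k * x * √(1 - x^2)^k / (1 - x^2))) x := by
  have h1 : HasDerivAt (fun t : ℝ => 1 - t^2) (-(2 * x)) x := by
    simpa using (hasDerivAt_pow 2 x).const_sub 1
  refine ((h1.sqrt hx.ne').pow k).congr_deriv ?_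
  rcases k with _ | k
  · simp
  · have hr : √(1 - x^2)^2 = 1 - x^2 := Real.sq_sqrt hx.le
    have hr0 : √(1 - x^2) ≠ 0 := (Real.sqrt_pos.2 hx).ne'
    rw [← hr, Real.sqrt_sq (Real.sqrt_nonneg _), Nat.add_sub_cancel]
    field_simp
    ring

lemma hasDerivAt_sphHarmonic (n k : ℕ) {x : ℝ} (hx : 0 < 1 - x^2) :
    HasDerivAt (sphHarmonic n k) (sphHarmonicDeriv n k x / (1 - x^2)) x := by
  refine (((hasDerivAt_sqrt_one_sub_sq_pow k hx).mul
    (hasDerivAt_rodrigues n (n + k) x)).const_mul (sphHarmonicConst n k)).congr_deriv ?_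
  rw [sphHarmonicDeriv]
  field_simp
  ring

lemma hasDerivAt_sphHarmonicDeriv (n k : ℕ) {x : ℝ} (hx : 0 < 1 - x^2) :
    HasDerivAt (sphHarmonicDeriv n k)
      (-(n * (n + 1) * (1 - x^2) - k^2) * sphHarmonic n k x / (1 - x^2)) x := by
  have h1 : HasDerivAt (fun t : ℝ => 1 - t^2) (-(2 * x)) x := by
    simpa using (hasDerivAt_pow 2 x).const_sub 1
  have h2 : HasDerivAt (fun t : ℝ => k * t) (k:ℝ) x := by
    simpa using (hasDerivAt_id x).const_mul (k:ℝ)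
  refine (((hasDerivAt_sqrt_one_sub_sq_pow k hx).mul
    ((h1.mul (hasDerivAt_rodrigues n (n + k + 1) x)).sub
      (h2.mul (hasDerivAt_rodrigues n (n + k) x)))).const_mul
        (sphHarmonicConst n k)).congr_deriv ?_
  have ode := rodrigues_ode n (n + k) x
  push_cast at ode
  rw [sphHarmonic]
  simp only [Pi.mul_apply, Pi.sub_apply]
  rw [show n + k + 1 + 1 = n + k + 2 by ring]
  generalize √(1 - x^2)^k = s
  field_simp
  linear_combination (-sphHarmonicConst n k * s * (1 - x^2)) * ode

lemma isLegendreSystem_sphHarmonic {n : ℕ} (k : ℕ) (hn : 0 < n) :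
    IsLegendreSystem (n * (n + 1)) k (sphHarmonic n k) (sphHarmonicDeriv n k) where
  L_pos := by positivity
  cont_y := (continuous_sphHarmonic n k).continuousOn
  cont_z := (continuous_sphHarmonicDeriv n k).continuousOn
  z_one := by
    rcases Nat.eq_zero_or_pos k with rfl | hk
    · simp [sphHarmonicDeriv]
    · simp [sphHarmonicDeriv, hk.ne']
  y_one := by
    rcases Nat.eq_zero_or_pos k with rfl | hk
    · simp
    · simp [sphHarmonic, hk.ne']
  deriv_y := fun x hx => hasDerivAt_sphHarmonic n k (by nlinarith [hx.1, hx.2])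
  deriv_z := fun x hx => hasDerivAt_sphHarmonicDeriv n k (by nlinarith [hx.1, hx.2])

lemma sphHarmonic_zero (n k : ℕ) :
    sphHarmonic n k 0 = sphHarmonicConst n k * rodrigues n (n + k) 0 := by
  simp [sphHarmonic]

lemma sphHarmonicDeriv_zero (n k : ℕ) :
    sphHarmonicDeriv n k 0 = sphHarmonicConst n k * rodrigues n (n + k + 1) 0 := by
  simp [sphHarmonicDeriv]

lemma sphHarmonic_zero_sq {n k p q : ℕ} (hp : n + k = 2 * p) (hq : n - k = 2 * q) (hk : k ≤ n) :
    sphHarmonic n k 0^2 =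
      (2 * (n:ℝ) + 1) / (4 * Real.pi) * (wallisRatio p * wallisRatio q) := by
  obtain rfl : n = p + q := by omega
  rw [sphHarmonic_zero, mul_pow, sphHarmonicConst_sq, hp, hq, rodrigues_zero_sq, wallisRatio,
    wallisRatio, pow_add]
  field_simp

lemma sphHarmonicDeriv_zero_sq {n k p q : ℕ} (hp : n + k + 1 = 2 * p) (hq : n - k = 2 * q + 1)
    (hk : k ≤ n) :
    sphHarmonicDeriv n k 0^2 =
      (2 * (n:ℝ) + 1) / (4 * Real.pi) * ((2 * p) * (2 * q + 1)) *
        (wallisRatio p * wallisRatio q) := by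
  obtain rfl : n = p + q := by omega
  rw [sphHarmonicDeriv_zero, mul_pow, sphHarmonicConst_sq, hp, hq, rodrigues_zero_sq, wallisRatio,
    wallisRatio, pow_add, Nat.factorial_succ]
  have e : ((2 * p).factorial : ℝ) = 2 * p * (p + q + k).factorial := by
    rw [← hp, Nat.factorial_succ, hp]
    push_cast
    ring
  rw [e]
  push_cast
  field_simp

lemma wallisRatio_mul_sq_le (p q : ℕ) :
    (wallisRatio p * wallisRatio q)^2 ≤ 1 / ((2 * p + 1) * (2 * q + 1)) := by
  have := mul_le_mul (wallisRatio_sq_le p) (wallisRatio_sq_le q) (by positivity) (by positivity)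
  rw [mul_pow]
  exact this.trans_eq (by field_simp)

lemma sphHarmonic_zero_sq_le {n k : ℕ} {κ : ℝ} (hk : k ≤ n) (hκ : 0 < κ) (hκ1 : κ ≤ 1)
    (h : (k:ℝ)^2 ≤ (1 - κ) * ((n:ℝ) + 1/2)^2) : sphHarmonic n k 0^2 ≤ 1 / κ := by
  rcases Nat.even_or_odd (n + k) with ⟨p, hp⟩ | ho
  · obtain ⟨q, hq⟩ : ∃ q, n - k = 2 * q := ⟨p - k, by omega⟩
    have hp' : n + k = 2 * p := by omega
    have e : (2 * (p:ℝ) + 1) * (2 * q + 1) = (n + 1)^2 - k^2 := by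
      have h1 : (n:ℝ) + k = 2 * p := by exact_mod_cast hp'
      have h2 : (n:ℝ) = 2 * q + k := by exact_mod_cast (by omega : n = 2 * q + k)
      linear_combination (-(n:ℝ) + k - 1) * h1 - (2 * p + 1) * h2
    have hpi := Real.pi_gt_three
    refine (pow_le_pow_iff_left₀ (by positivity) (by positivity) two_ne_zero).1 ?_
    have hn : (0:ℝ) ≤ n := by positivity
    have hden : κ * (n + 1/2)^2 ≤ (n + 1)^2 - (k:ℝ)^2 := by nlinarith
    rw [sphHarmonic_zero_sq hp' hq hk, mul_pow]
    calc _ ≤ ((2 * (n:ℝ) + 1) / (4 * 3))^2 * (1 / (κ * (n + 1/2)^2)) := by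
          gcongr
          exact (wallisRatio_mul_sq_le p q).trans (by rw [e]; gcongr)
      _ = 1 / (36 * κ) := by field_simp; ring
      _ ≤ (1 / κ)^2 := by
          rw [div_pow, one_pow, div_le_div_iff₀ (by positivity) (by positivity)]
          nlinarith
  · rw [sphHarmonic_zero, rodrigues_zero_of_odd ho]
    simp
    positivity

lemma sphHarmonicDeriv_zero_sq_le {n k : ℕ} (hk : k ≤ n) :
    sphHarmonicDeriv n k 0^2 ≤ ((n:ℝ) + 1/2)^2 := by
  rcases Nat.even_or_odd (n + k) with he | ⟨p, hp⟩
  · rw [sphHarmonicDeriv_zero, rodrigues_zero_of_odd he.add_one]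
    simp
    positivity
  · obtain ⟨q, hq⟩ : ∃ q, n - k = 2 * q + 1 := ⟨p - k, by omega⟩
    have hp' : n + k + 1 = 2 * (p + 1) := by omega
    have h1 : (2 * ((p + 1 : ℕ) : ℝ)) = n + k + 1 := by exact_mod_cast hp'.symm
    have h2 : (2 * (q:ℝ) + 1) = n - k := by
      rw [← Nat.cast_sub hk, hq]
      push_cast
      ring
    have hpi := Real.pi_gt_three
    refine (pow_le_pow_iff_left₀ (by positivity) (by positivity) two_ne_zero).1 ?_
    rw [sphHarmonicDeriv_zero_sq hp' hq hk, mul_pow, mul_pow]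
    set P : ℝ := 2 * ((p + 1 : ℕ) : ℝ) with hP
    set R : ℝ := 2 * (q:ℝ) + 1 with hR
    have hP0 : 0 < P := by positivity
    have hR0 : 0 < R := by positivity
    have hPR : P * R ≤ ((n:ℝ) + 1/2)^2 := by
      rw [h1, h2]
      nlinarith [sq_nonneg ((k:ℝ) + 1/2)]
    calc _ ≤ ((2 * (n:ℝ) + 1) / (4 * 3))^2 * (P * R)^2 * (1 / (P * R)) := by
          gcongr
          refine (wallisRatio_mul_sq_le (p + 1) q).trans ?_
          gcongr
          linarith
      _ = ((n:ℝ) + 1/2)^2 * (P * R) / 36 := by field_simp; ring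
      _ ≤ (((n:ℝ) + 1/2)^2)^2 := by
          have : ((n:ℝ) + 1/2)^2 * (P * R) ≤ ((n:ℝ) + 1/2)^2 * ((n:ℝ) + 1/2)^2 := by gcongr
          nlinarith [sq_nonneg (((n:ℝ) + 1/2)^2)]

end LegendreFunctions

section Bounds

lemma abs_le_mul_rpow_of_pow_four_mul_le {y W C : ℝ} (hW : 0 < W) (hC : 0 ≤ C)
    (h : y^4 * W ≤ C^4) : |y| ≤ C * W ^ (-(1:ℝ)/4) := by
  have e : (W ^ (-(1:ℝ)/4))^4 = W⁻¹ := by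
    rw [← Real.rpow_natCast, ← Real.rpow_mul hW.le, ← Real.rpow_neg_one]
    norm_num
  refine (pow_le_pow_iff_left₀ (abs_nonneg y) (by positivity) four_ne_zero).1 ?_
  rw [mul_pow, e, Even.pow_abs (by decide), ← div_eq_mul_inv, le_div_iff₀ hW]
  exact h

lemma sphHarmonic_pow_four_mul_add_le {n k : ℕ} {κ x M : ℝ} (hk : k ≤ n) (hκ : 0 < κ) (hκ1 : κ ≤ 1)
    (hkκ : (k:ℝ)^2 ≤ (1 - κ) * ((n:ℝ) + 1/2)^2) (hbig : 1024 ≤ ((n:ℝ) + 1/2)^2 * κ^3)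
    (hn : 0 < n) (hM0 : 0 < M) (hM : M^3 = (1 + (k:ℝ))^4) (hx : x ∈ Icc (-1:ℝ) 1) :
    sphHarmonic n k x^4 * (M + |n * (n + 1) * (1 - x^2) - (k:ℝ)^2|) ≤
      IsLegendreSystem.uniformConst κ * ((n:ℝ) + 1/2)^2 := by
  have hn1 : (1:ℝ) ≤ n := by exact_mod_cast hn
  have hkn : (k:ℝ) ≤ n := by exact_mod_cast hk
  have := (isLegendreSystem_sphHarmonic k hn).pow_four_mul_add_le (lam := (n:ℝ) + 1/2)
    (x := |x|) hκ hκ1 (by linarith) (by ring) hkκ (by linarith) hbig hM0 hM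
    (sphHarmonic_zero_sq_le hk hκ hκ1 hkκ)
    ((sphHarmonicDeriv_zero_sq_le hk).trans (by
      rw [le_div_iff₀ hκ]
      exact mul_le_of_le_one_right (by positivity) hκ1))
    ⟨abs_nonneg x, abs_le.2 hx⟩
  rwa [sq_abs, ← Even.pow_abs (by decide), abs_sphHarmonic_abs, Even.pow_abs (by decide)] at this

lemma sphHarmonic_pow_four_mul_le {n k : ℕ} {κ x M : ℝ} (hk : k ≤ n) (hκ : 0 < κ) (hκ1 : κ ≤ 1)
    (hkκ : (k:ℝ)^2 ≤ (1 - κ) * ((n:ℝ) + 1/2)^2) (hbig : 1024 ≤ ((n:ℝ) + 1/2)^2 * κ^3)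
    (hn : 0 < n) (hM0 : 0 < M) (hM : M^3 = (1 + (k:ℝ))^4) (hx : x ∈ Icc (-1:ℝ) 1) :
    sphHarmonic n k x^4 * (M / (1 + n)^2 + |x^2 - (1 - (k / ((n:ℝ) + 1/2))^2)|) ≤
      2 * IsLegendreSystem.uniformConst κ := by
  have h := sphHarmonic_pow_four_mul_add_le hk hκ hκ1 hkκ hbig hn hM0 hM hx
  set lam : ℝ := (n:ℝ) + 1/2 with hlam
  have hl : 0 < lam := by positivity
  have hM1 : 1 ≤ M := by
    by_contra! hlt
    have : M^3 < 1 := pow_lt_one₀ hM0.le hlt (by norm_num)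
    have : (1:ℝ) ≤ (1 + (k:ℝ))^4 := one_le_pow₀ (by simp)
    linarith
  have hx2 : x^2 ≤ 1 := by nlinarith [hx.1, hx.2]
  have e1 : lam^2 * |x^2 - (1 - (k / lam)^2)| =
      |(n * (n + 1) * (1 - x^2) - (k:ℝ)^2) + (1 - x^2) / 4| := by
    have e : lam^2 * (x^2 - (1 - (k / lam)^2)) =
        -((n * (n + 1) * (1 - x^2) - (k:ℝ)^2) + (1 - x^2) / 4) := by
      field_simp
      rw [hlam]
      ring
    rw [← abs_neg (n * (n + 1) * (1 - x^2) - (k:ℝ)^2 + _), ← e, abs_mul,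
      abs_of_pos (by positivity : 0 < lam^2)]
  have e2 : lam^2 * (M / (1 + n)^2) ≤ M := by
    rw [mul_div_assoc', div_le_iff₀ (by positivity), mul_comm]
    gcongr
    linarith
  have e3 : lam^2 * (M / (1 + n)^2 + |x^2 - (1 - (k / lam)^2)|) ≤
      2 * (M + |n * (n + 1) * (1 - x^2) - (k:ℝ)^2|) := by
    rw [mul_add, e1]
    have t1 := abs_add_le (n * (n + 1) * (1 - x^2) - (k:ℝ)^2) ((1 - x^2) / 4)
    rw [abs_of_nonneg (by linarith : 0 ≤ (1 - x^2) / 4)] at t1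
    have t2 := abs_nonneg (n * (n + 1) * (1 - x^2) - (k:ℝ)^2)
    nlinarith [sq_nonneg x]
  have e4 := mul_le_mul_of_nonneg_left e3 (by positivity : 0 ≤ sphHarmonic n k x^4)
  refine le_of_mul_le_mul_left ?_ (by positivity : 0 < lam^2)
  linarith

lemma one_add_rpow_four_thirds_pow_three (k : ℕ) :
    ((1 + (k:ℝ)) ^ ((4:ℝ)/3))^3 = (1 + (k:ℝ))^4 := by
  rw [← Real.rpow_natCast, ← Real.rpow_mul (by positivity), ← Real.rpow_natCast]
  norm_num

lemma sphHarmonic_mul_two_pow_pow_four_mul_le {n k : ℕ} {κ x : ℝ} (hk : k ≤ n) (hκ : 0 < κ)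
    (hκ1 : κ ≤ 1) (hkκ : (k:ℝ)^2 ≤ (1 - κ) * ((n:ℝ) + 1/2)^2)
    (hbig : 1024 ≤ ((n:ℝ) + 1/2)^2 * κ^3) (hk0 : 0 < k) (hx : x ∈ Icc (-1:ℝ) 1)
    (hxk : √(1 - x^2) ≤ k / ((n:ℝ) + 1/2) / 4) :
    (sphHarmonic n k x * 2^k)^4 * (k / ((n:ℝ) + 1/2))^2 ≤ 2 * IsLegendreSystem.uniformConst κ := by
  have hn : 0 < n := by omega
  have hsys := isLegendreSystem_sphHarmonic k hn
  have hkn : (k:ℝ) ≤ n := by exact_mod_cast hk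
  have hk1 : (1:ℝ) ≤ k := by exact_mod_cast hk0
  obtain ⟨a, ha, hQa⟩ := hsys.exists_level (s := 7/16 * (k:ℝ)^2) (by positivity) (by nlinarith)
  have hx2 : 0 ≤ 1 - x^2 := by nlinarith [hx.1, hx.2]
  have hQx : n * (n + 1) * (1 - |x|^2) ≤ 1/16 * (k:ℝ)^2 := by
    rw [Real.sqrt_le_left (by positivity)] at hxk
    rw [sq_abs]
    have : (1 - x^2) * ((n:ℝ) + 1/2)^2 ≤ 1/16 * (k:ℝ)^2 := by
      calc _ ≤ (k / ((n:ℝ) + 1/2) / 4)^2 * ((n:ℝ) + 1/2)^2 := by gcongr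
        _ = _ := by field_simp; norm_num
    nlinarith
  have hya := hsys.abs_mul_two_pow_le ha.1 (abs_nonneg x) (abs_le.2 hx) hk0 hQa hQx
  rw [abs_sphHarmonic_abs] at hya
  have h := sphHarmonic_pow_four_mul_add_le hk hκ hκ1 hkκ hbig hn
    (by positivity) (one_add_rpow_four_thirds_pow_three k)
    (⟨by linarith [ha.1], ha.2⟩ : a ∈ Icc (-1:ℝ) 1)
  have hQ : |n * (n + 1) * (1 - a^2) - (k:ℝ)^2| = 9/16 * (k:ℝ)^2 := by
    rw [hQa, abs_sub_comm, abs_of_nonneg (by nlinarith)]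
    ring
  rw [hQ] at h
  have h4 : (sphHarmonic n k x * 2^k)^4 ≤ sphHarmonic n k a^4 := by
    rw [← Even.pow_abs (by decide : Even 4), ← Even.pow_abs (by decide : Even 4)
      (sphHarmonic n k a)]
    refine pow_le_pow_left₀ (abs_nonneg _) ?_ 4
    rwa [abs_mul, abs_of_pos (by positivity : (0:ℝ) < 2^k)]
  have hy4 : 0 ≤ sphHarmonic n k a^4 := by positivity
  have hP : 0 ≤ sphHarmonic n k a^4 * (1 + (k:ℝ)) ^ ((4:ℝ)/3) := by positivity
  have hu := IsLegendreSystem.uniformConst_pos hκ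
  rw [div_pow, mul_div_assoc', div_le_iff₀ (by positivity)]
  have : (sphHarmonic n k x * 2^k)^4 * (k:ℝ)^2 ≤ sphHarmonic n k a^4 * (k:ℝ)^2 := by gcongr
  have hul : 0 ≤ IsLegendreSystem.uniformConst κ * ((n:ℝ) + 1/2)^2 := by positivity
  nlinarith

lemma exists_sphHarmonic_bound (N : ℕ) : ∃ B : ℝ, 0 < B ∧
    ∀ n < N, ∀ k ≤ n, ∀ x ∈ Icc (-1:ℝ) 1, |sphHarmonic n k x| ≤ B := by
  choose B hB using fun n k => (isCompact_Icc (a := (-1:ℝ)) (b := 1)).exists_bound_of_continuousOn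
    (continuous_sphHarmonic n k).continuousOn
  refine ⟨1 + ∑ n ∈ Finset.range N, ∑ k ∈ Finset.range N, |B n k|, by positivity, ?_⟩
  intro n hn k hk x hx
  have h1 : |B n k| ≤ ∑ k ∈ Finset.range N, |B n k| :=
    Finset.single_le_sum (f := fun k => |B n k|) (fun _ _ => abs_nonneg _)
      (Finset.mem_range.2 (by omega))
  have h2 : ∑ k ∈ Finset.range N, |B n k| ≤ ∑ n ∈ Finset.range N, ∑ k ∈ Finset.range N, |B n k| :=
    Finset.single_le_sum (f := fun n => ∑ k ∈ Finset.range N, |B n k|)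
      (fun _ _ => by positivity) (Finset.mem_range.2 hn)
  have h3 := hB n k x hx
  rw [Real.norm_eq_abs] at h3
  linarith [le_abs_self (B n k)]

lemma one_half_le_rpow_neg_quarter {W : ℝ} (hW : 0 < W) (hW2 : W ≤ 2) :
    1/2 ≤ W ^ (-(1:ℝ)/4) := by
  calc (1:ℝ)/2 = 2 ^ (-(1:ℝ)) := by rw [Real.rpow_neg_one]; norm_num
    _ ≤ 2 ^ (-(1:ℝ)/4) := Real.rpow_le_rpow_of_exponent_le (by norm_num) (by norm_num)
    _ ≤ W ^ (-(1:ℝ)/4) := Real.rpow_le_rpow_of_nonpos hW hW2 (by norm_num)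

lemma weight_le_two {n k : ℕ} {b x : ℝ} (hk : k ≤ n) (hb0 : 0 ≤ b) (hb1 : b ≤ 1)
    (hx : x ∈ Icc (-1:ℝ) 1) :
    (1 + (k:ℝ)) ^ ((4:ℝ)/3) / (1 + (n:ℝ))^2 + |x^2 - (1 - b^2)| ≤ 2 := by
  have hkn : (k:ℝ) ≤ n := by exact_mod_cast hk
  have h1 : (1 + (k:ℝ)) ^ ((4:ℝ)/3) / (1 + (n:ℝ))^2 ≤ 1 := by
    rw [div_le_one (by positivity), ← Real.rpow_natCast]
    calc (1 + (k:ℝ)) ^ ((4:ℝ)/3) ≤ (1 + (n:ℝ)) ^ ((4:ℝ)/3) := by gcongr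
      _ ≤ _ := Real.rpow_le_rpow_of_exponent_le (by simp) (by norm_num)
  have h2 : |x^2 - (1 - b^2)| ≤ 1 := by
    rw [abs_le]
    constructor <;> nlinarith [hx.1, hx.2]
  linarith

lemma le_mul_rpow_mul_of_le {k N : ℕ} {B b y : ℝ} (hB : 0 ≤ B) (hb0 : 0 < b) (hb1 : b ≤ 1)
    (hk : k ≤ N) (hy : y ≤ B) : y ≤ B * 2^(N + 1) * b ^ (-(1:ℝ)/2) * ((2:ℝ)^k)⁻¹ := by
  have h1 : 1 ≤ b ^ (-(1:ℝ)/2) := Real.one_le_rpow_of_pos_of_le_one_of_nonpos hb0 hb1 (by norm_num)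
  calc y ≤ B * 2^(N + 1) * 1 * (2^N)⁻¹ := by
        rw [pow_succ]
        field_simp
        linarith
    _ ≤ _ := by
        gcongr
        norm_num

lemma abs_sphHarmonic_le_rpow {n k : ℕ} {κ x C : ℝ} (hk : k ≤ n) (hκ : 0 < κ) (hκ1 : κ ≤ 1)
    (hkκ : (k:ℝ)^2 ≤ (1 - κ) * ((n:ℝ) + 1/2)^2) (hbig : 1024 ≤ ((n:ℝ) + 1/2)^2 * κ^3)
    (hn : 0 < n) (hx : x ∈ Icc (-1:ℝ) 1) (hC : 0 ≤ C)
    (hC4 : 2 * IsLegendreSystem.uniformConst κ ≤ C^4) :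
    |sphHarmonic n k x| ≤ C * ((1 + (k:ℝ)) ^ ((4:ℝ)/3) / (1 + (n:ℝ))^2 +
      |x^2 - (1 - (k / ((n:ℝ) + 1/2))^2)|) ^ (-(1:ℝ)/4) :=
  abs_le_mul_rpow_of_pow_four_mul_le (by positivity) hC
    ((sphHarmonic_pow_four_mul_le hk hκ hκ1 hkκ hbig hn (by positivity)
      (one_add_rpow_four_thirds_pow_three k) hx).trans hC4)

lemma abs_sphHarmonic_le_two_pow_inv {n k : ℕ} {κ x C : ℝ} (hk : k ≤ n) (hκ : 0 < κ) (hκ1 : κ ≤ 1)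
    (hkκ : (k:ℝ)^2 ≤ (1 - κ) * ((n:ℝ) + 1/2)^2) (hbig : 1024 ≤ ((n:ℝ) + 1/2)^2 * κ^3)
    (hk0 : 0 < k) (hx : x ∈ Icc (-1:ℝ) 1) (hxk : √(1 - x^2) ≤ k / ((n:ℝ) + 1/2) / 4)
    (hC : 0 ≤ C) (hC4 : 2 * IsLegendreSystem.uniformConst κ ≤ C^4) :
    |sphHarmonic n k x| ≤ C * (k / ((n:ℝ) + 1/2)) ^ (-(1:ℝ)/2) * ((2:ℝ)^k)⁻¹ := by
  set b : ℝ := k / ((n:ℝ) + 1/2) with hb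
  have hb0 : 0 < b := by positivity
  have h1 := abs_le_mul_rpow_of_pow_four_mul_le (by positivity : 0 < b^2) hC
    ((sphHarmonic_mul_two_pow_pow_four_mul_le hk hκ hκ1 hkκ hbig hk0 hx hxk).trans hC4)
  have h2 : (b^2) ^ (-(1:ℝ)/4) = b ^ (-(1:ℝ)/2) := by
    rw [← Real.rpow_natCast, ← Real.rpow_mul hb0.le]
    norm_num
  rwa [h2, abs_mul, abs_of_pos (by positivity : (0:ℝ) < 2^k), ← le_div_iff₀ (by positivity),
    div_eq_mul_inv] at h1

end Bounds

/-- bounds for spherical harmonics in the Bessel regime `|m| ≤ ε(ℓ+1/2)`. -/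
theorem statement13 (ε : ℝ) (hε : ε ∈ Set.Ioo (0:ℝ) 1) :
    ∃ C : ℝ, 0 < C ∧
      ∀ (n : ℕ) (m : ℤ), m.natAbs ≤ n → |(m:ℝ)| ≤ ε * ((n:ℝ) + 1/2) →
        ∀ x : ℝ, x ∈ Set.Icc (-1 : ℝ) 1 →
          |tY n m x| ≤
              C * ((1 + |(m:ℝ)|) ^ ((4:ℝ)/3) / (1 + (n:ℝ))^2 + |x^2 - alm n m ^ 2|)
                ^ (-(1:ℝ)/4) ∧
            (1 ≤ m.natAbs → Real.sqrt (1 - x^2) ≤ blm n m / 4 →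
              |tY n m x| ≤ C * blm n m ^ (-(1:ℝ)/2) * ((2:ℝ) ^ (m.natAbs : ℕ))⁻¹) := by
  obtain ⟨hε0, hε1⟩ := hε
  set κ : ℝ := 1 - ε^2 with hκdef
  have hκ : 0 < κ := by nlinarith
  have hκ1 : κ ≤ 1 := by nlinarith
  obtain ⟨N, hN⟩ := exists_nat_ge (1024 / κ^3)
  obtain ⟨B, hB, hBbd⟩ := exists_sphHarmonic_bound N
  have hu := IsLegendreSystem.uniformConst_pos hκ
  set C₁ : ℝ := max 1 (2 * IsLegendreSystem.uniformConst κ) with hC₁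
  have hC₁1 : 1 ≤ C₁ := le_max_left _ _
  have hC₁4 : 2 * IsLegendreSystem.uniformConst κ ≤ C₁^4 :=
    (le_max_right _ _).trans (le_self_pow₀ hC₁1 four_ne_zero)
  refine ⟨max C₁ (B * 2^(N + 1)), by positivity, ?_⟩
  intro n m hmn hmε x hx
  set k : ℕ := m.natAbs with hkdef
  have hmk : |(m:ℝ)| = k := by rw [hkdef, Nat.cast_natAbs, Int.cast_abs]
  rw [hmk] at hmε ⊢
  set b : ℝ := k / ((n:ℝ) + 1/2) with hb
  have hblm : blm n m = b := by rw [blm, hmk]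
  have hkn : (k:ℝ) ≤ n := by exact_mod_cast hmn
  have hlam : (0:ℝ) < n + 1/2 := by positivity
  have hb0 : 0 ≤ b := by positivity
  have hb1 : b ≤ 1 := by rw [hb, div_le_one hlam]; linarith
  have halm : alm n m^2 = 1 - b^2 := by
    rw [alm, hblm, Real.sq_sqrt (by nlinarith)]
  rw [abs_tY n m hmn, halm, hblm]
  have hkκ : (k:ℝ)^2 ≤ (1 - κ) * ((n:ℝ) + 1/2)^2 := by
    rw [hκdef, sub_sub_cancel, ← mul_pow]
    gcongr
  rcases lt_or_ge n N with hnN | hnN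
  · have hy := hBbd n hnN k hmn x hx
    refine ⟨?_, fun hk hxb => ?_⟩
    · have hW := one_half_le_rpow_neg_quarter (by positivity) (weight_le_two hmn hb0 hb1 hx)
      have hpN : (1:ℝ) ≤ 2^N := one_le_pow₀ (by norm_num)
      calc |sphHarmonic n k x| ≤ B * 2^(N + 1) * (1/2) := by
            rw [pow_succ]
            nlinarith
        _ ≤ _ := mul_le_mul (le_max_right _ _) hW (by norm_num) (by positivity)
    · refine (le_mul_rpow_mul_of_le hB.le (by positivity : 0 < b) hb1
        (by omega : k ≤ N) hy).trans ?_
      gcongr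
      exact le_max_right _ _
  · have hbig : 1024 ≤ ((n:ℝ) + 1/2)^2 * κ^3 := by
      rw [div_le_iff₀ (by positivity)] at hN
      have hNn : (N:ℝ) ≤ n := by exact_mod_cast hnN
      refine hN.trans ?_
      gcongr
      nlinarith
    have hn : 0 < n := by
      by_contra! h0
      have hn0 : (n:ℝ) = 0 := by exact_mod_cast Nat.le_zero.1 h0
      have : κ^3 ≤ 1 := pow_le_one₀ hκ.le hκ1
      rw [hn0] at hbig
      linarith
    have hC₁0 : 0 ≤ C₁ := by linarith
    refine ⟨?_, fun hk hxb => ?_⟩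
    · refine (abs_sphHarmonic_le_rpow hmn hκ hκ1 hkκ hbig hn hx hC₁0 hC₁4).trans ?_
      gcongr
      exact le_max_left _ _
    · refine (abs_sphHarmonic_le_two_pow_inv hmn hκ hκ1 hkκ hbig hk hx hxb hC₁0 hC₁4).trans ?_
      gcongr
      exact le_max_left _ _
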